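/- arXiv:1407.2496 — 2 statements merged into one kernel-verified Lean document; each statement's English description precedes it below -/
import Mathlib

section
/- Let L/K be a totally ramified Galois extension of degree p and let t be its (unique) upper ramification jump. Then t = min{ j ∈ ℕ : U_K^{j+1} ⊆ N_{L/K}(L^×) }. -/
noncomputable section

open scoped Classical

namespace PaperRam

/-- An additive `ℤ ∪ {∞}`-valued valuation on a field is *normalized* if it is
surjective onto `ℤ`. -/
def IsNormalized {F : Type*} [Field F] (v : AddValuation F (WithTop ℤ)) : Prop :=
  ∀ n : ℤ, ∃ x : F, v x = (n : WithTop ℤ)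

/-- The normalized valuation `vF` of `F` extends the normalized valuation `vK` of `K`
with ramification index `e`, i.e. `vF(x) = e · vK(x)` for all `x ∈ K`. -/
def Extends {K F : Type*} [Field K] [Field F] [Algebra K F]
    (vK : AddValuation K (WithTop ℤ)) (vF : AddValuation F (WithTop ℤ)) (e : ℕ) : Prop :=
  0 < e ∧ ∀ x : K, vF (algebraMap K F x) = e • vK x

/-- `v` is the normalized valuation of the `p`-adic field `K`, with (absolute)
ramification index `eK` over `ℚ_p`. -/
def IsPadicValuation (p : ℕ) [Fact p.Prime] {K : Type*} [Field K] [Algebra ℚ_[p] K]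
    (v : AddValuation K (WithTop ℤ)) (eK : ℕ) : Prop :=
  IsNormalized v ∧ 0 < eK ∧
    ∀ x : ℚ_[p], x ≠ 0 → v (algebraMap ℚ_[p] K x) = ((eK * x.valuation : ℤ) : WithTop ℤ)

/-- The valuation `v` of `F` is invariant under all `K`-algebra automorphisms of `F`. -/
def GalInvariant (K : Type*) {F : Type*} [Field K] [Field F] [Algebra K F]
    (v : AddValuation F (WithTop ℤ)) : Prop :=
  ∀ (σ : F ≃ₐ[K] F) (x : F), v (σ x) = v x

variable {K F : Type*} [Field K] [Field F] [Algebra K F]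

/-- The lower-numbering ramification subgroup `G_i` of `Gal(F/K)`:
`σ ∈ G_i ↔ v(σ x − x) ≥ i + 1` for all `x` in the valuation ring of `F`. -/
def lowerRG (v : AddValuation F (WithTop ℤ)) (hv : GalInvariant K v) (i : ℤ) :
    Subgroup (F ≃ₐ[K] F) where
  carrier := {σ | ∀ x : F, 0 ≤ v x → ((i + 1 : ℤ) : WithTop ℤ) ≤ v (σ x - x)}
  one_mem' := by
    intro x _
    simp
  mul_mem' := by
    intro a b ha hb x hx
    have h1 : ((i + 1 : ℤ) : WithTop ℤ) ≤ v (a (b x) - b x) :=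
      ha (b x) (by rw [hv b x]; exact hx)
    have h2 := hb x hx
    have hrw : (a * b) x - x = (a (b x) - b x) + (b x - x) := by
      rw [AlgEquiv.mul_apply]; ring
    rw [hrw]
    exact v.map_le_add h1 h2
  inv_mem' := by
    intro a ha x hx
    have hda : a (a⁻¹ x - x) = x - a x := by
      rw [map_sub]
      congr 1
      exact a.apply_symm_apply x
    have : v (a⁻¹ x - x) = v (a x - x) := by
      rw [← hv a (a⁻¹ x - x), hda, v.map_sub_swap]
    rw [this]
    exact ha x hx

/-- The Herbrand function `φ_{F/K}` evaluated at integers. -/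
def herbrandPhi (v : AddValuation F (WithTop ℤ)) (hv : GalInvariant K v) (n : ℤ) : ℚ :=
  if n ≤ 0 then (n : ℚ)
  else (∑ i ∈ Finset.Icc (1 : ℤ) n, (Nat.card (lowerRG v hv i) : ℚ)) /
    (Nat.card (lowerRG v hv 0) : ℚ)

/-- The upper-numbering ramification subgroup `G^u = G_{ψ(u)}` of `Gal(F/K)`. -/
def upperRG (v : AddValuation F (WithTop ℤ)) (hv : GalInvariant K v) (u : ℤ) :
    Subgroup (F ≃ₐ[K] F) :=
  lowerRG v hv (sInf {n : ℤ | (u : ℚ) ≤ herbrandPhi v hv n})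

/-- `t` is an upper ramification jump of `F/K`: `G^u ≠ G^t` for every `u > t`. -/
def IsUpperJump (v : AddValuation F (WithTop ℤ)) (hv : GalInvariant K v) (t : ℤ) : Prop :=
  ∀ u : ℤ, t < u → upperRG v hv u ≠ upperRG v hv t

/-- A group is elementary abelian of exponent `p` if it is isomorphic to `(ℤ/pℤ)^k`
for some `k`. -/
def IsElemAbelian (p : ℕ) (G : Type*) [Group G] : Prop :=
  ∃ k : ℕ, Nonempty (G ≃* (Fin k → Multiplicative (ZMod p)))

/-- The norm group `N_{L/K}(L^×)`, as a subgroup of `K^×`. -/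
def normGroup (K L : Type*) [Field K] [Field L] [Algebra K L] : Subgroup Kˣ :=
  (Units.map (Algebra.norm K : L →* K)).range

/-- The residues of `c 0, …, c (f-1)` lie in the valuation ring and form a basis of
the residue field of `v` over `𝔽_p`. -/
def IsResidueBasis (p : ℕ) {K : Type*} [Field K] (v : AddValuation K (WithTop ℤ))
    {f : ℕ} (c : Fin f → K) : Prop :=
  (∀ y, 0 ≤ v (c y)) ∧
  (∀ a : Fin f → ℤ, (1 : WithTop ℤ) ≤ v (∑ y, (a y : K) * c y) → ∀ y, (p : ℤ) ∣ a y) ∧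
  (∀ x : K, 0 ≤ v x → ∃ a : Fin f → ℤ, (1 : WithTop ℤ) ≤ v (x - ∑ y, (a y : K) * c y))

/-- `v_L(𝒟_{L/K})`: the valuation of the different of `L/K`, defined through the
inverse different `{x ∈ L ∣ Tr_{L/K}(x·𝒪_L) ⊆ 𝒪_K} = 𝔪_L^{-d}`. -/
def differentVal (K : Type*) {L : Type*} [Field K] [Field L] [Algebra K L]
    (vK : AddValuation K (WithTop ℤ)) (vL : AddValuation L (WithTop ℤ)) : ℤ :=
  sSup {m : ℤ | ∃ x : L, vL x = ((-m : ℤ) : WithTop ℤ) ∧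
    ∀ y : L, 0 ≤ vL y → 0 ≤ vK (Algebra.trace K L (x * y))}

/-- The maximal elementary abelian `p`-extension `𝒞_K(p)` of `K` inside `Ω`: the
compositum of all cyclic (equivalently, normal) extensions of `K` of degree `p`. -/
def maxElemAbelian (p : ℕ) (K Ω : Type*) [Field K] [Field Ω] [Algebra K Ω] :
    IntermediateField K Ω :=
  ⨆ L ∈ {L : IntermediateField K Ω | Module.finrank K L = p ∧ Normal K L}, L

/-- The subgroup `U_K^{i+1} = 1 + 𝔪_K^{i+1}` of principal units of `K^×`
(the index is shifted by one so that `principalUnits v 0 = U_K^1`). -/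
def principalUnits {K : Type*} [Field K] (v : AddValuation K (WithTop ℤ)) (i : ℕ) :
    Subgroup Kˣ where
  carrier := {x : Kˣ | (((i : ℤ) + 1 : ℤ) : WithTop ℤ) ≤ v ((x : K) - 1)}
  one_mem' := by simp
  mul_mem' := by
    intro a b ha hb
    have hpos : (0 : WithTop ℤ) < (((i : ℤ) + 1 : ℤ) : WithTop ℤ) := by
      rw [show (0 : WithTop ℤ) = ((0 : ℤ) : WithTop ℤ) from rfl]
      exact WithTop.coe_lt_coe.mpr (by omega)
    have hva : v (a : K) = 0 := by
      have h1 : v ((1 : K)) < v ((a : K) - 1) := by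
        rw [v.map_one]; exact lt_of_lt_of_le hpos ha
      have h2 := v.map_add_eq_of_lt_right h1
      rw [sub_add_cancel] at h2
      rw [h2, v.map_one]
    have key : ((a * b : Kˣ) : K) - 1 = (a : K) * ((b : K) - 1) + ((a : K) - 1) := by
      push_cast; ring
    show (((i : ℤ) + 1 : ℤ) : WithTop ℤ) ≤ v (((a * b : Kˣ) : K) - 1)
    rw [key]
    refine v.map_le_add ?_ ha
    rw [v.map_mul, hva, zero_add]
    exact hb
  inv_mem' := by
    intro a ha
    have hpos : (0 : WithTop ℤ) < (((i : ℤ) + 1 : ℤ) : WithTop ℤ) := by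
      rw [show (0 : WithTop ℤ) = ((0 : ℤ) : WithTop ℤ) from rfl]
      exact WithTop.coe_lt_coe.mpr (by omega)
    have hva : v (a : K) = 0 := by
      have h1 : v ((1 : K)) < v ((a : K) - 1) := by
        rw [v.map_one]; exact lt_of_lt_of_le hpos ha
      have h2 := v.map_add_eq_of_lt_right h1
      rw [sub_add_cancel] at h2
      rw [h2, v.map_one]
    have key : ((a⁻¹ : Kˣ) : K) - 1 = ((a : K))⁻¹ * (1 - (a : K)) := by
      rw [mul_sub, mul_one, inv_mul_cancel₀ (Units.ne_zero a)]
      push_cast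
      ring
    show (((i : ℤ) + 1 : ℤ) : WithTop ℤ) ≤ v (((a⁻¹ : Kˣ) : K) - 1)
    rw [key, v.map_mul, v.map_inv, hva, v.map_sub_swap]
    simpa using ha

section Valuation

open Polynomial

lemma coe_mul_le_nsmul {p : ℕ} (hp : 0 < p) {m : ℤ} {a : WithTop ℤ} :
    ((p * m : ℤ) : WithTop ℤ) ≤ p • a ↔ (m : WithTop ℤ) ≤ a := by
  induction a using WithTop.recTopCoe with
  | top =>
    obtain ⟨q, rfl⟩ := Nat.exists_eq_succ_of_ne_zero hp.ne'
    simp [succ_nsmul]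
  | coe a =>
    rw [← WithTop.coe_nsmul, WithTop.coe_le_coe, WithTop.coe_le_coe, nsmul_eq_mul]
    exact mul_le_mul_iff_right₀ (by exact_mod_cast hp)

lemma coe_mul_eq_nsmul (p : ℕ) (a : ℤ) :
    p • (a : WithTop ℤ) = ((p * a : ℤ) : WithTop ℤ) := by
  rw [← WithTop.coe_nsmul, nsmul_eq_mul]

/-- Divisibility by `p` improves a lower bound on `p • a`. -/
lemma coe_le_of_lt_nsmul {p : ℕ} (hp : 0 < p) {m n : ℤ} {a : WithTop ℤ}
    (h : (n : WithTop ℤ) ≤ p • a) (hmn : p * m < n + p) : (m : WithTop ℤ) ≤ a := by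
  induction a using WithTop.recTopCoe with
  | top => exact le_top
  | coe a =>
    rw [coe_mul_eq_nsmul, WithTop.coe_le_coe] at h
    rw [WithTop.coe_le_coe]
    have hp' : (0 : ℤ) < p := by exact_mod_cast hp
    by_contra! hlt
    have : (p : ℤ) * (a + 1) ≤ p * m := mul_le_mul_of_nonneg_left hlt hp'.le
    linarith

lemma exists_coe_eq_of_ne_zero {F : Type*} [Field F] (v : AddValuation F (WithTop ℤ)) {x : F}
    (hx : x ≠ 0) : ∃ n : ℤ, v x = n := by
  have := (v.ne_top_iff).2 hx
  exact ⟨(v x).untop this, (WithTop.coe_untop _ _).symm⟩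

lemma ne_zero_of_val_eq_coe {F : Type*} [Field F] (v : AddValuation F (WithTop ℤ)) {x : F} {n : ℤ}
    (hx : v x = n) : x ≠ 0 := by
  rintro rfl
  simp at hx

lemma val_div_of_eq {F : Type*} [Field F] (v : AddValuation F (WithTop ℤ)) {x y : F} {m n : ℤ}
    (hx : (m : WithTop ℤ) ≤ v x) (hy : v y = n) : ((m - n : ℤ) : WithTop ℤ) ≤ v (x / y) := by
  have hy0 := ne_zero_of_val_eq_coe v hy
  have h : v x = v (x / y) + n := by rw [← hy, ← v.map_mul, div_mul_cancel₀ _ hy0]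
  rw [h] at hx
  revert hx
  induction v (x / y) using WithTop.recTopCoe with
  | top => simp
  | coe a =>
    intro hx
    norm_cast at hx ⊢
    omega

lemma val_mul_ge {F : Type*} [Field F] (v : AddValuation F (WithTop ℤ)) {x y : F} {m n : ℤ}
    (hx : (m : WithTop ℤ) ≤ v x) (hy : (n : WithTop ℤ) ≤ v y) :
    ((m + n : ℤ) : WithTop ℤ) ≤ v (x * y) := by
  rw [v.map_mul, WithTop.coe_add]
  exact add_le_add hx hy

lemma val_pow_ge {F : Type*} [Field F] (v : AddValuation F (WithTop ℤ)) {x : F} {m : ℤ}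
    (hx : (m : WithTop ℤ) ≤ v x) (k : ℕ) : ((k * m : ℤ) : WithTop ℤ) ≤ v (x ^ k) := by
  rw [v.map_pow, ← coe_mul_eq_nsmul]
  exact nsmul_le_nsmul_right hx k

lemma val_eq_zero_of_sub_one {F : Type*} [Field F] (v : AddValuation F (WithTop ℤ)) {x : F}
    (hx : ((1 : ℤ) : WithTop ℤ) ≤ v (x - 1)) : v x = 0 := by
  have h1 : v (1 : F) < v (x - 1) := by
    rw [v.map_one]
    exact lt_of_lt_of_le (by exact_mod_cast zero_lt_one) hx
  have h2 := v.map_add_eq_of_lt_right h1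
  rwa [sub_add_cancel, v.map_one] at h2

lemma val_div_sub_one {F : Type*} [Field F] (v : AddValuation F (WithTop ℤ)) {x y : F} {m : ℤ}
    (hy : v y = 0) (h : (m : WithTop ℤ) ≤ v (x - y)) : (m : WithTop ℤ) ≤ v (x / y - 1) := by
  have hy0 : y ≠ 0 := ne_zero_of_val_eq_coe v (n := 0) hy
  have := val_div_of_eq v (n := 0) h hy
  rwa [sub_div, div_self hy0, sub_zero] at this

/-- If no two summands share a finite valuation, the valuation of the sum is at most that of
each summand. -/
lemma val_sum_le_of_distinct {F ι : Type*} [Field F] (v : AddValuation F (WithTop ℤ))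
    (s : Finset ι) (f : ι → F)
    (h : ∀ i ∈ s, ∀ j ∈ s, v (f i) = v (f j) → v (f i) ≠ ⊤ → i = j) {i : ι} (hi : i ∈ s) :
    v (∑ j ∈ s, f j) ≤ v (f i) := by
  obtain ⟨i₀, hi₀, hmin⟩ := s.exists_min_image (fun j => v (f j)) ⟨i, hi⟩
  refine le_trans ?_ (hmin i hi)
  by_cases htop : v (f i₀) = ⊤
  · rw [htop]; exact le_top
  rw [← Finset.add_sum_erase s f hi₀]
  refine (v.map_add_eq_of_lt_left (v.map_lt_sum htop fun j hj => ?_)).le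
  rw [Finset.mem_erase] at hj
  exact lt_of_le_of_ne (hmin j hj.2) fun he => hj.1 (h i₀ hi₀ j hj.2 he htop).symm

variable {p : ℕ} {K L : Type*} [Field K] [Field L] [Algebra K L]
  {vK : AddValuation K (WithTop ℤ)} {vL : AddValuation L (WithTop ℤ)}

lemma val_aeval_le (hext : Extends vK vL p) {π : L} (hπ : vL π = ((1 : ℤ) : WithTop ℤ))
    (P : K[X]) (hP : P.natDegree < p) (i : ℕ) (hi : i < p) :
    vL (aeval π P) ≤ p • vK (P.coeff i) + ((i : ℤ) : WithTop ℤ) := by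
  have hval : ∀ j, vL (P.coeff j • π ^ j) = p • vK (P.coeff j) + ((j : ℤ) : WithTop ℤ) := by
    intro j
    rw [Algebra.smul_def, vL.map_mul, hext.2, vL.map_pow, hπ, coe_mul_eq_nsmul, mul_one]
  rw [aeval_eq_sum_range' hP, ← hval]
  refine val_sum_le_of_distinct vL _ _ ?_ (Finset.mem_range.2 hi)
  intro j hj k hk hjk htop
  rw [Finset.mem_range] at hj hk
  have hj0 : P.coeff j ≠ 0 := fun h0 => htop (by simp [h0])
  have hk0 : P.coeff k ≠ 0 := fun h0 => htop (by rw [hjk]; simp [h0])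
  obtain ⟨a, ha⟩ := exists_coe_eq_of_ne_zero vK hj0
  obtain ⟨b, hb⟩ := exists_coe_eq_of_ne_zero vK hk0
  rw [hval, hval, ha, hb, coe_mul_eq_nsmul, coe_mul_eq_nsmul] at hjk
  norm_cast at hjk
  have h1 := congrArg (· % (p : ℤ)) hjk
  simp only [Int.mul_add_emod_self_left] at h1
  rw [Int.emod_eq_of_lt, Int.emod_eq_of_lt] at h1 <;> omega

lemma val_norm [FiniteDimensional K L] [IsGalois K L] (hdeg : Module.finrank K L = p)
    (hext : Extends vK vL p) (hGal : GalInvariant K vL) (x : L) :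
    vK (Algebra.norm K x) = vL x := by
  have h : p • vK (Algebra.norm K x) = p • vL x := by
    rw [← hext.2, Algebra.norm_eq_prod_automorphisms]
    have key : ∀ s : Finset (L ≃ₐ[K] L), vL (∏ σ ∈ s, σ x) = s.card • vL x := by
      intro s
      induction s using Finset.induction_on with
      | empty => simp
      | insert σ s hσ ih =>
        rw [Finset.prod_insert hσ, vL.map_mul, ih, hGal, Finset.card_insert_of_notMem hσ,
          succ_nsmul']
    rw [key, Finset.card_univ, ← Nat.card_eq_fintype_card, IsGalois.card_aut_eq_finrank, hdeg]
  have key : ∀ m : ℤ, (m : WithTop ℤ) ≤ vK (Algebra.norm K x) ↔ (m : WithTop ℤ) ≤ vL x := by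
    intro m
    rw [← coe_mul_le_nsmul hext.1, h, coe_mul_le_nsmul hext.1]
  by_cases hx : x = 0
  · simp [hx, Algebra.norm_zero]
  obtain ⟨n, hn⟩ := exists_coe_eq_of_ne_zero vL hx
  obtain ⟨m, hm⟩ := exists_coe_eq_of_ne_zero vK (Algebra.norm_ne_zero_iff.2 hx)
  have h1 := (key m).1 hm.ge
  have h2 := (key n).2 hn.ge
  rw [hn] at h1
  rw [hm] at h2
  rw [hm, hn]
  exact le_antisymm h1 h2

lemma exists_aeval_eq [hp : Fact p.Prime] [FiniteDimensional K L]
    (hdeg : Module.finrank K L = p)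
    (hext : Extends vK vL p) {π : L} (hπ : vL π = ((1 : ℤ) : WithTop ℤ)) (y : L) :
    ∃ P : K[X], P.natDegree < p ∧ aeval π P = y := by
  have hbot : π ∉ (⊥ : Subalgebra K L) := by
    rintro ⟨x, hx⟩
    have hx0 : x ≠ 0 := by
      rintro rfl
      apply ne_zero_of_val_eq_coe vL hπ
      rw [← hx]; simp
    obtain ⟨n, hn⟩ := exists_coe_eq_of_ne_zero vK hx0
    have h := hext.2 x
    change algebraMap K L x = π at hx
    rw [hx, hn, hπ, coe_mul_eq_nsmul] at h
    have h' : (1 : ℤ) = p * n := by exact_mod_cast h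
    have : (p : ℤ) ∣ 1 := ⟨n, h'⟩
    exact hp.out.one_lt.ne' (by exact_mod_cast Int.eq_one_of_dvd_one (by positivity) this)
  have htop : Algebra.adjoin K {π} = ⊤ := by
    have hs := Subalgebra.isSimpleOrder_of_finrank_prime K L (hdeg ▸ hp.out)
    refine (hs.eq_bot_or_eq_top _).resolve_left fun hb => hbot ?_
    rw [← hb]
    exact Algebra.subset_adjoin rfl
  let pb := PowerBasis.ofAdjoinEqTop' (Algebra.IsIntegral.isIntegral (R := K) π) htop
  obtain ⟨P, hP, hy⟩ := pb.exists_eq_aeval y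
  refine ⟨P, ?_, ?_⟩
  · rwa [← pb.finrank, hdeg] at hP
  · rw [hy, PowerBasis.ofAdjoinEqTop'_gen]

end Valuation

section Ramification

open Polynomial

lemma val_natCast_of_padic {p : ℕ} [Fact p.Prime] {K : Type*} [Field K] [Algebra ℚ_[p] K]
    {vK : AddValuation K (WithTop ℤ)} {eK : ℕ} (hvK : IsPadicValuation p vK eK) {n : ℕ}
    (hn : n ≠ 0) : vK (n : K) = ((eK * padicValNat p n : ℤ) : WithTop ℤ) := by
  have h := hvK.2.2 (n : ℚ_[p]) (by exact_mod_cast hn)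
  rwa [map_natCast, Padic.valuation_natCast] at h

lemma val_pow_sub_pow {F : Type*} [Field F] (v : AddValuation F (WithTop ℤ)) {a b : F} {s : ℤ}
    (ha : ((0 : ℤ) : WithTop ℤ) ≤ v a) (hb : ((0 : ℤ) : WithTop ℤ) ≤ v b)
    (h : (s : WithTop ℤ) ≤ v (a - b)) (i : ℕ) : (s : WithTop ℤ) ≤ v (a ^ i - b ^ i) := by
  induction i with
  | zero => simp
  | succ i ih =>
    have e : a ^ (i + 1) - b ^ (i + 1) = a * (a ^ i - b ^ i) + b ^ i * (a - b) := by ring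
    rw [e]
    refine v.map_le_add ?_ ?_
    · simpa using val_mul_ge v ha ih
    · simpa using val_mul_ge v (val_pow_ge v hb i) h

lemma val_prod_sub_pow {F ι : Type*} [Field F] (v : AddValuation F (WithTop ℤ)) {c : F} {m : ℤ}
    (hc : ((0 : ℤ) : WithTop ℤ) ≤ v c) (s : Finset ι) (f : ι → F)
    (hf : ∀ i ∈ s, ((0 : ℤ) : WithTop ℤ) ≤ v (f i))
    (h : ∀ i ∈ s, (m : WithTop ℤ) ≤ v (f i - c)) :
    (m : WithTop ℤ) ≤ v (∏ i ∈ s, f i - c ^ s.card) := by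
  induction s using Finset.induction_on with
  | empty => simp
  | insert i s hi ih =>
    have e : (∏ j ∈ insert i s, f j) - c ^ (insert i s).card =
        f i * (∏ j ∈ s, f j - c ^ s.card) + c ^ s.card * (f i - c) := by
      rw [Finset.prod_insert hi, Finset.card_insert_of_notMem hi]; ring
    have ih := ih (fun j hj => hf j (Finset.mem_insert_of_mem hj))
      (fun j hj => h j (Finset.mem_insert_of_mem hj))
    rw [e]
    refine v.map_le_add ?_ ?_
    · simpa using val_mul_ge v (hf i (Finset.mem_insert_self i s)) ih
    · simpa using val_mul_ge v (val_pow_ge v hc s.card) (h i (Finset.mem_insert_self i s))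

lemma val_sub_one_of_pow_prime {F : Type*} [Field F] (v : AddValuation F (WithTop ℤ)) {p : ℕ}
    (hp : p.Prime) (hvp : ((1 : ℤ) : WithTop ℤ) ≤ v (p : F)) {u : F}
    (hu : ((0 : ℤ) : WithTop ℤ) ≤ v u) (h : ((1 : ℤ) : WithTop ℤ) ≤ v (u ^ p - 1)) :
    ((1 : ℤ) : WithTop ℤ) ≤ v (u - 1) := by
  let O : Subring F :=
    { carrier := {x | ((0 : ℤ) : WithTop ℤ) ≤ v x}
      mul_mem' := fun ha hb => by simpa using val_mul_ge v ha hb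
      one_mem' := by simp
      add_mem' := fun ha hb => v.map_le_add ha hb
      zero_mem' := by simp
      neg_mem' := fun ha => by simpa using ha }
  obtain ⟨r, hr⟩ := exists_add_pow_prime_eq hp ((⟨u, hu⟩ : O) - 1) 1
  have hr' : u ^ p = (u - 1) ^ p + 1 + p * ((u - 1) * r) := by
    have := congrArg (fun x : O => (x : F)) hr
    simp only [sub_add_cancel, one_pow, mul_one] at this
    push_cast at this
    rw [← mul_assoc]
    exact this
  have hpow : ((1 : ℤ) : WithTop ℤ) ≤ v ((u - 1) ^ p) := by
    have e : (u - 1) ^ p = (u ^ p - 1) - p * ((u - 1) * r) := by rw [hr']; ring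
    rw [e]
    have hur := val_mul_ge v (v.map_le_sub hu (show ((0 : ℤ) : WithTop ℤ) ≤ v 1 by simp)) r.2
    exact v.map_le_sub h (by simpa using val_mul_ge v hvp hur)
  rw [v.map_pow] at hpow
  exact coe_le_of_lt_nsmul hp.pos hpow (by omega)

variable {p : ℕ} [hp : Fact p.Prime] {K L : Type*} [Field K] [Field L] [Algebra K L]
  [FiniteDimensional K L] {vK : AddValuation K (WithTop ℤ)} {vL : AddValuation L (WithTop ℤ)}

lemma val_aut_sub_ge (hdeg : Module.finrank K L = p)
    (hext : Extends vK vL p) (hGal : GalInvariant K vL) {π : L}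
    (hπ : vL π = ((1 : ℤ) : WithTop ℤ)) {σ : L ≃ₐ[K] L} {s : ℤ}
    (hs : (s : WithTop ℤ) ≤ vL (σ π - π)) {x : L} (hx : ((0 : ℤ) : WithTop ℤ) ≤ vL x) :
    (s : WithTop ℤ) ≤ vL (σ x - x) := by
  obtain ⟨P, hP, rfl⟩ := exists_aeval_eq hdeg hext hπ x
  have hπ0 : ((0 : ℤ) : WithTop ℤ) ≤ vL π := by rw [hπ]; exact_mod_cast zero_le_one
  have e : σ (aeval π P) - aeval π P =
      ∑ i ∈ Finset.range p, algebraMap K L (P.coeff i) * ((σ π) ^ i - π ^ i) := by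
    rw [← aeval_algHom_apply, aeval_eq_sum_range' hP, aeval_eq_sum_range' hP,
      ← Finset.sum_sub_distrib]
    simp [Algebra.smul_def, mul_sub]
  rw [e]
  refine vL.map_le_sum fun i hi => ?_
  rw [Finset.mem_range] at hi
  have hc : ((0 : ℤ) : WithTop ℤ) ≤ vK (P.coeff i) := by
    have h1 := hx.trans (val_aeval_le hext hπ P hP i hi)
    have h2 : ((-i : ℤ) : WithTop ℤ) ≤ p • vK (P.coeff i) := by
      revert h1
      induction p • vK (P.coeff i) using WithTop.recTopCoe with
      | top => simp
      | coe a =>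
        intro h1
        norm_cast at h1
        rw [WithTop.coe_le_coe]
        omega
    exact coe_le_of_lt_nsmul hp.out.pos h2 (by omega)
  have hc' : ((0 : ℤ) : WithTop ℤ) ≤ vL (algebraMap K L (P.coeff i)) := by
    rw [hext.2]
    simpa using (coe_mul_le_nsmul hp.out.pos).2 hc
  simpa using val_mul_ge vL hc' (val_pow_sub_pow vL (by rw [hGal]; exact hπ0) hπ0 hs i)

lemma mem_lowerRG_iff (hdeg : Module.finrank K L = p)
    (hext : Extends vK vL p) (hGal : GalInvariant K vL) {π : L}
    (hπ : vL π = ((1 : ℤ) : WithTop ℤ)) (σ : L ≃ₐ[K] L) (i : ℤ) :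
    σ ∈ lowerRG vL hGal i ↔ ((i + 1 : ℤ) : WithTop ℤ) ≤ vL (σ π - π) := by
  refine ⟨fun h => h π ?_, fun h x hx => val_aut_sub_ge hdeg hext hGal hπ h hx⟩
  rw [hπ]
  exact_mod_cast zero_le_one

/-- A totally ramified extension of degree `p` is wildly ramified. -/
lemma two_le_val_aut_sub [IsGalois K L] (hdeg : Module.finrank K L = p)
    (hext : Extends vK vL p) (hGal : GalInvariant K vL)
    (hvp : ((1 : ℤ) : WithTop ℤ) ≤ vK (p : K)) {π : L}
    (hπ : vL π = ((1 : ℤ) : WithTop ℤ)) (σ : L ≃ₐ[K] L) :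
    ((2 : ℤ) : WithTop ℤ) ≤ vL (σ π - π) := by
  have hπ0 : π ≠ 0 := ne_zero_of_val_eq_coe vL hπ
  have hG0 : ∀ (τ : L ≃ₐ[K] L) (x : L), ((0 : ℤ) : WithTop ℤ) ≤ vL x →
      ((1 : ℤ) : WithTop ℤ) ≤ vL (τ x - x) := fun τ x hx =>
    val_aut_sub_ge hdeg hext hGal hπ (vL.map_le_sub (by rw [hGal, hπ]) hπ.ge) hx
  have hvpL : ((1 : ℤ) : WithTop ℤ) ≤ vL (p : L) := by
    have h := (coe_mul_le_nsmul hp.out.pos).2 hvp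
    rw [← hext.2, map_natCast] at h
    refine le_trans ?_ h
    have := hp.out.one_le
    rw [WithTop.coe_le_coe]
    omega
  set u := σ π / π with hu
  have hmul : u * π = σ π := div_mul_cancel₀ _ hπ0
  have hu0 : ((0 : ℤ) : WithTop ℤ) ≤ vL u := by
    have := val_div_of_eq vL (x := σ π) (by rw [hGal, hπ]) hπ
    rwa [sub_self] at this
  have hNσ : Algebra.norm K (σ π) = Algebra.norm K π := Algebra.norm_eq_of_algEquiv σ π
  have hN : Algebra.norm K u = 1 := by
    have h := congrArg (Algebra.norm K) hmul
    rw [map_mul, hNσ] at h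
    exact mul_eq_right₀ (Algebra.norm_ne_zero_iff.2 hπ0) |>.1 h
  have hprod : ((1 : ℤ) : WithTop ℤ) ≤ vL (∏ τ : L ≃ₐ[K] L, τ u - u ^ p) := by
    have hcard : (Finset.univ : Finset (L ≃ₐ[K] L)).card = p := by
      rw [Finset.card_univ, ← Nat.card_eq_fintype_card, IsGalois.card_aut_eq_finrank, hdeg]
    have := val_prod_sub_pow vL hu0 (Finset.univ : Finset (L ≃ₐ[K] L)) (fun τ => τ u)
      (m := 1) (fun τ _ => by rwa [hGal]) (fun τ _ => hG0 τ u hu0)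
    rwa [hcard] at this
  rw [← Algebra.norm_eq_prod_automorphisms, hN, map_one, vL.map_sub_swap] at hprod
  have h1 := val_sub_one_of_pow_prime vL hp.out hvpL hu0 hprod
  have e : σ π - π = (u - 1) * π := by rw [sub_mul, hmul, one_mul]
  rw [e]
  exact val_mul_ge vL h1 hπ.ge

/-- The upper jump `t` is positive and governs the action of every nontrivial automorphism
on a uniformizer. -/
lemma val_aut_sub_of_isUpperJump [IsGalois K L] (hdeg : Module.finrank K L = p)
    (hext : Extends vK vL p) (hGal : GalInvariant K vL)
    (hvp : ((1 : ℤ) : WithTop ℤ) ≤ vK (p : K)) {π : L}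
    (hπ : vL π = ((1 : ℤ) : WithTop ℤ)) {t : ℤ} (ht : IsUpperJump vL hGal t) :
    1 ≤ t ∧ (∃ σ : L ≃ₐ[K] L, σ ≠ 1) ∧
      ∀ σ : L ≃ₐ[K] L, σ ≠ 1 → vL (σ π - π) = ((t + 1 : ℤ) : WithTop ℤ) := by
  have hcard : Nat.card (L ≃ₐ[K] L) = p := by rw [IsGalois.card_aut_eq_finrank, hdeg]
  have hpp : (0 : ℚ) < p := by exact_mod_cast hp.out.pos
  have : Fact (Nat.card (L ≃ₐ[K] L)).Prime := ⟨hcard ▸ hp.out⟩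
  have : Nontrivial (L ≃ₐ[K] L) := Finite.one_lt_card_iff_nontrivial.1 (hcard ▸ hp.out.one_lt)
  have hmem := mem_lowerRG_iff hdeg hext hGal hπ
  obtain ⟨σ₀, hσ₀⟩ := exists_ne (1 : L ≃ₐ[K] L)
  have hfin : σ₀ π - π ≠ 0 := by
    intro h0
    refine hσ₀ (AlgEquiv.ext fun x => ?_)
    obtain ⟨P, -, rfl⟩ := exists_aeval_eq hdeg hext hπ x
    rw [← aeval_algHom_apply, sub_eq_zero.1 h0]
    rfl
  obtain ⟨n₀, hn₀⟩ := exists_coe_eq_of_ne_zero vL hfin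
  have hn₀2 := two_le_val_aut_sub hdeg hext hGal hvp hπ σ₀
  rw [hn₀, WithTop.coe_le_coe] at hn₀2
  obtain ⟨s, rfl⟩ : ∃ s, n₀ = s + 1 := ⟨n₀ - 1, by ring⟩
  have hs : 1 ≤ s := by omega
  have htop : ∀ i ≤ s, lowerRG vL hGal i = ⊤ := by
    intro i hi
    refine ((lowerRG vL hGal i).eq_bot_or_eq_top_of_prime_card).resolve_left fun hb => hσ₀ ?_
    rw [← Subgroup.mem_bot, ← hb, hmem, hn₀, WithTop.coe_le_coe]
    omega
  have hbot : ∀ i, s < i → lowerRG vL hGal i = ⊥ := by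
    intro i hi
    refine ((lowerRG vL hGal i).eq_bot_or_eq_top_of_prime_card).resolve_right fun hb => ?_
    have : σ₀ ∈ lowerRG vL hGal i := hb ▸ Subgroup.mem_top σ₀
    rw [hmem, hn₀, WithTop.coe_le_coe] at this
    omega
  have hcard_le : ∀ i, Nat.card (lowerRG vL hGal i) ≤ p := fun i =>
    hcard ▸ Subgroup.card_le_card_group _
  have hc0 : Nat.card (lowerRG vL hGal 0) = p := by
    rw [htop 0 (by omega), Subgroup.card_top, hcard]
  have hIcc : ∀ n : ℤ, 0 < n → (((Finset.Icc (1 : ℤ) n).card : ℕ) : ℚ) = n := by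
    intro n hn
    rw [Int.card_Icc, add_sub_cancel_right]
    exact_mod_cast Int.toNat_of_nonneg hn.le
  have hphi_le : ∀ n : ℤ, herbrandPhi vL hGal n ≤ n := by
    intro n
    unfold herbrandPhi
    split_ifs with h
    · exact le_rfl
    · rw [hc0, div_le_iff₀ hpp, ← hIcc n (by omega), ← nsmul_eq_mul]
      exact Finset.sum_le_card_nsmul _ _ _ fun i _ => by exact_mod_cast hcard_le i
  have hphi_ge : ∀ n : ℤ, 0 < n → (n : ℚ) / p ≤ herbrandPhi vL hGal n := by
    intro n hn
    unfold herbrandPhi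
    rw [if_neg (by omega), hc0]
    gcongr
    rw [← hIcc n hn, ← nsmul_one]
    exact Finset.card_nsmul_le_sum _ _ _ fun i _ => by exact_mod_cast Nat.card_pos
  have hphi_s : herbrandPhi vL hGal s = s := by
    unfold herbrandPhi
    rw [if_neg (by omega), hc0, div_eq_iff hpp.ne', ← hIcc s (by omega), ← nsmul_eq_mul]
    refine Finset.sum_eq_card_nsmul fun i hi => ?_
    rw [htop i (Finset.mem_Icc.1 hi).2, Subgroup.card_top, hcard]
  have hlb : ∀ u n : ℤ, (u : ℚ) ≤ herbrandPhi vL hGal n → u ≤ n := fun u n h => by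
    exact_mod_cast h.trans (hphi_le n)
  have hbot' : ∀ u, s < u → upperRG vL hGal u = ⊥ := by
    intro u hu
    refine hbot _ (lt_of_lt_of_le hu (le_csInf ⟨p * u, ?_⟩ (hlb u)))
    have hu0 : (0 : ℤ) < p * u := mul_pos (by exact_mod_cast hp.out.pos) (by omega)
    refine le_trans ?_ (hphi_ge _ hu0)
    push_cast
    rw [mul_div_cancel_left₀ _ hpp.ne']
  have htop' : ∀ u ≤ s, upperRG vL hGal u = ⊤ := by
    intro u hu
    refine htop _ (csInf_le ⟨u, hlb u⟩ ?_)
    change (u : ℚ) ≤ herbrandPhi vL hGal s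
    rw [hphi_s]
    exact_mod_cast hu
  have hts : t = s := by
    rcases lt_trichotomy t s with h | h | h
    · exact absurd ((htop' s le_rfl).trans (htop' t h.le).symm) (ht s h)
    · exact h
    · exact absurd ((hbot' (t + 1) (by omega)).trans (hbot' t h).symm) (ht (t + 1) (by omega))
  subst hts
  refine ⟨hs, ⟨σ₀, hσ₀⟩, fun σ hσ => le_antisymm ?_ ?_⟩
  · by_contra! hlt
    refine hσ ?_
    rw [← Subgroup.mem_bot, ← hbot (t + 1) (by omega), hmem]
    revert hlt
    induction vL (σ π - π) using WithTop.recTopCoe with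
    | top => simp
    | coe a => simp only [WithTop.coe_lt_coe, WithTop.coe_le_coe]; omega
  · rw [← hmem, htop t le_rfl]
    exact Subgroup.mem_top σ

end Ramification

section TraceNorm

open Polynomial

variable {p : ℕ} [hp : Fact p.Prime] {K L : Type*} [Field K] [Field L] [Algebra K L]
  [FiniteDimensional K L] [IsGalois K L]
  {vK : AddValuation K (WithTop ℤ)} {vL : AddValuation L (WithTop ℤ)}

omit hp in
lemma card_aut_univ (hdeg : Module.finrank K L = p) :
    (Finset.univ : Finset (L ≃ₐ[K] L)).card = p := by
  rw [Finset.card_univ, ← Nat.card_eq_fintype_card, IsGalois.card_aut_eq_finrank, hdeg]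

omit hp in
/-- Euler's formula for the trace of a quotient by the derivative of the minimal polynomial. -/
lemma trace_aeval_div_prod (hdeg : Module.finrank K L = p) {π : L}
    (hinj : ∀ σ : L ≃ₐ[K] L, σ ≠ 1 → σ π ≠ π) (P : K[X]) (hP : P.natDegree < p) :
    Algebra.trace K L (aeval π P / ∏ τ ∈ Finset.univ.erase (1 : L ≃ₐ[K] L), (π - τ π)) =
      P.coeff (p - 1) := by
  apply (algebraMap K L).injective
  have hinj' : Set.InjOn (fun σ : L ≃ₐ[K] L => σ π) (Finset.univ : Finset (L ≃ₐ[K] L)) := by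
    intro σ _ τ _ h
    by_contra hne
    refine hinj (τ⁻¹ * σ) (fun h1 => hne (inv_mul_eq_one.1 h1).symm) ?_
    change σ π = τ π at h
    rw [AlgEquiv.mul_apply, h]
    exact τ.symm_apply_apply π
  have hdegP : (P.map (algebraMap K L)).degree < (Finset.univ : Finset (L ≃ₐ[K] L)).card := by
    rw [card_aut_univ hdeg]
    refine degree_le_natDegree.trans_lt ?_
    rw [natDegree_map]
    exact_mod_cast hP
  have hL := Lagrange.coeff_eq_sum hinj' hdegP
  rw [card_aut_univ hdeg, coeff_map] at hL
  rw [trace_eq_sum_automorphisms, hL]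
  refine Finset.sum_congr rfl fun σ _ => ?_
  rw [map_div₀, map_prod, ← aeval_algHom_apply, eval_map_algebraMap]
  congr 1
  refine Finset.prod_equiv (Equiv.mulLeft σ) (fun τ => ?_) (fun τ _ => ?_)
  · simp
  · simp

variable (hdeg : Module.finrank K L = p) (hext : Extends vK vL p) (hGal : GalInvariant K vL)
  {π : L} (hπ : vL π = ((1 : ℤ) : WithTop ℤ)) {t : ℤ}
  (hjump : ∀ σ : L ≃ₐ[K] L, σ ≠ 1 → vL (σ π - π) = ((t + 1 : ℤ) : WithTop ℤ))

include hdeg hjump in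
lemma val_prod_sub_aut :
    vL (∏ τ ∈ Finset.univ.erase (1 : L ≃ₐ[K] L), (π - τ π)) =
      (((p - 1) * (t + 1) : ℤ) : WithTop ℤ) := by
  have key : ∀ s : Finset (L ≃ₐ[K] L), 1 ∉ s →
      vL (∏ τ ∈ s, (π - τ π)) = ((s.card * (t + 1) : ℤ) : WithTop ℤ) := by
    intro s hs
    induction s using Finset.induction_on with
    | empty => simp
    | insert σ s hσ ih =>
      rw [Finset.mem_insert, not_or] at hs
      rw [Finset.prod_insert hσ, vL.map_mul, ih hs.2, vL.map_sub_swap, hjump σ (Ne.symm hs.1),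
        Finset.card_insert_of_notMem hσ, ← WithTop.coe_add]
      congr 1
      push_cast
      ring
  rw [key _ (Finset.notMem_erase _ _), Finset.card_erase_of_mem (Finset.mem_univ _),
    card_aut_univ hdeg, Nat.cast_sub hp.out.one_le, Nat.cast_one]

omit [FiniteDimensional K L] [IsGalois K L] in
include hjump in
lemma aut_ne_of_jump (σ : L ≃ₐ[K] L) (hσ : σ ≠ 1) : σ π ≠ π :=
  sub_ne_zero.1 (ne_zero_of_val_eq_coe vL (hjump σ hσ))

include hdeg hext hπ hjump in
lemma val_trace_ge {y : L} {n m : ℤ} (hy : (n : WithTop ℤ) ≤ vL y)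
    (hm : p * m ≤ n + (p - 1) * (t + 1)) : (m : WithTop ℤ) ≤ vK (Algebra.trace K L y) := by
  have hD := val_prod_sub_aut (vL := vL) hdeg hjump
  set D := ∏ τ ∈ Finset.univ.erase (1 : L ≃ₐ[K] L), (π - τ π) with hDdef
  obtain ⟨P, hP, hPy⟩ := exists_aeval_eq hdeg hext hπ (y * D)
  have htr := trace_aeval_div_prod hdeg (aut_ne_of_jump hjump) P hP
  rw [hPy, ← hDdef, mul_div_cancel_right₀ _ (ne_zero_of_val_eq_coe vL hD)] at htr
  have h1 := val_aeval_le hext hπ P hP (p - 1) (Nat.sub_lt hp.out.pos one_pos)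
  rw [hPy, ← htr] at h1
  have h2 := (val_mul_ge vL hy hD.ge).trans h1
  rw [Nat.cast_sub hp.out.one_le, Nat.cast_one] at h2
  have h3 : ((n + (p - 1) * (t + 1) - (p - 1) : ℤ) : WithTop ℤ) ≤
      p • vK (Algebra.trace K L y) := by
    revert h2
    induction p • vK (Algebra.trace K L y) using WithTop.recTopCoe with
    | top => simp
    | coe a =>
      intro h2
      norm_cast at h2 ⊢
      linarith
  exact coe_le_of_lt_nsmul hp.out.pos h3 (by linarith)

include hdeg hext hπ hjump in
lemma exists_trace_eq {a : K} {n : ℤ} (ha : (n : WithTop ℤ) ≤ vK a) :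
    ∃ y : L, Algebra.trace K L y = a ∧ ((p * n - (p - 1) * t : ℤ) : WithTop ℤ) ≤ vL y := by
  have hD := val_prod_sub_aut (vL := vL) hdeg hjump
  have htr := trace_aeval_div_prod hdeg (aut_ne_of_jump hjump) (C a * X ^ (p - 1))
    ((natDegree_C_mul_X_pow_le a (p - 1)).trans_lt (Nat.sub_lt hp.out.pos one_pos))
  rw [coeff_C_mul_X_pow, if_pos rfl] at htr
  refine ⟨_, htr, ?_⟩
  have h1 : ((p * n + (p - 1) : ℤ) : WithTop ℤ) ≤ vL (aeval π (C a * X ^ (p - 1))) := by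
    have e : aeval π (C a * X ^ (p - 1)) = algebraMap K L a * π ^ (p - 1) := by simp
    rw [e]
    refine val_mul_ge vL ?_ ?_
    · rw [hext.2]
      exact (coe_mul_le_nsmul hp.out.pos).2 ha
    · have := val_pow_ge vL hπ.ge (p - 1)
      rwa [Nat.cast_sub hp.out.one_le, Nat.cast_one, mul_one] at this
  have h2 := val_div_of_eq vL h1 hD
  convert h2 using 2
  ring

/-- Newton's identities bound the elementary symmetric functions of the conjugates of `y`. -/
lemma val_aeval_esymm_ge (hdeg : Module.finrank K L = p) (hext : Extends vK vL p)
    (hπ : vL π = ((1 : ℤ) : WithTop ℤ)) (ht : 1 ≤ t)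
    (hjump : ∀ σ : L ≃ₐ[K] L, σ ≠ 1 → vL (σ π - π) = ((t + 1 : ℤ) : WithTop ℤ))
    (hunit : ∀ j : ℕ, 0 < j → j < p → vK (j : K) = 0) {y : L} {n : ℤ}
    (hy : (n : WithTop ℤ) ≤ vL y) (j : ℕ) (hj0 : 0 < j) (hjp : j < p) (m : ℤ)
    (hm : p * m ≤ j * n + (p - 1) * (t + 1)) :
    ((p * m : ℤ) : WithTop ℤ) ≤
      vL (MvPolynomial.aeval (fun σ : L ≃ₐ[K] L => σ y) (MvPolynomial.esymm (L ≃ₐ[K] L) ℤ j)) := by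
  have hpsum : ∀ i : ℕ, ∀ m : ℤ, p * m ≤ i * n + (p - 1) * (t + 1) →
      ((p * m : ℤ) : WithTop ℤ) ≤ vL (MvPolynomial.aeval (fun σ : L ≃ₐ[K] L => σ y)
        (MvPolynomial.psum (L ≃ₐ[K] L) ℤ i)) := by
    intro i m hm
    have e : MvPolynomial.aeval (fun σ : L ≃ₐ[K] L => σ y) (MvPolynomial.psum (L ≃ₐ[K] L) ℤ i) =
        algebraMap K L (Algebra.trace K L (y ^ i)) := by
      rw [trace_eq_sum_automorphisms]
      simp [MvPolynomial.psum]
    rw [e, hext.2]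
    exact (coe_mul_le_nsmul hp.out.pos).2
      (val_trace_ge hdeg hext hπ hjump (val_pow_ge vL hy i) hm)
  have hsign : ∀ k : ℕ, ((0 : ℤ) : WithTop ℤ) ≤ vL ((-1) ^ k) := by
    intro k
    have := val_pow_ge vL (x := -1) (m := 0) (by simp) k
    rwa [mul_zero] at this
  induction j using Nat.strong_induction_on generalizing m with
  | _ j ih =>
  have hN := congrArg (MvPolynomial.aeval (fun σ : L ≃ₐ[K] L => σ y))
    (MvPolynomial.mul_esymm_eq_sum (L ≃ₐ[K] L) ℤ j)
  simp only [map_mul, map_sum, map_pow, map_neg, map_one, map_natCast] at hN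
  have hjL : vL (j : L) = 0 := by
    have := hext.2 (j : K)
    rwa [map_natCast, hunit j hj0 hjp, nsmul_zero] at this
  have hgoal : ((p * m : ℤ) : WithTop ℤ) ≤ vL ((j : L) *
      MvPolynomial.aeval (fun σ : L ≃ₐ[K] L => σ y) (MvPolynomial.esymm (L ≃ₐ[K] L) ℤ j)) := by
    rw [hN]
    rw [← zero_add ((p : ℤ) * m)]
    refine val_mul_ge vL (hsign (j + 1)) (vL.map_le_sum fun a ha => ?_)
    rw [Finset.mem_filter, Finset.HasAntidiagonal.mem_antidiagonal] at ha
    obtain ⟨hsum, hlt⟩ := ha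
    rcases Nat.eq_zero_or_pos a.1 with h0 | hpos
    · have ha2 : a.2 = j := by omega
      rw [h0, MvPolynomial.esymm_zero, map_one, pow_zero, one_mul, one_mul, ha2]
      exact hpsum j m hm
    · set d : ℤ := (p - 1) * (t + 1) with hd
      have hpZ : (2 : ℤ) ≤ p := by exact_mod_cast hp.out.two_le
      have hdp : (p : ℤ) ≤ d := by nlinarith
      have hj : (j : ℤ) = a.1 + a.2 := by exact_mod_cast hsum.symm
      set s₁ : ℤ := (a.1 * n + d) / p with hs₁
      set s₂ : ℤ := (a.2 * n + d) / p with hs₂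
      have hp0 : (0 : ℤ) < p := by omega
      have h1 := Int.mul_ediv_self_le (x := a.1 * n + d) hp0.ne'
      have h1' := Int.lt_mul_ediv_self_add (x := a.1 * n + d) hp0
      have h2 := Int.mul_ediv_self_le (x := a.2 * n + d) hp0.ne'
      have h2' := Int.lt_mul_ediv_self_add (x := a.2 * n + d) hp0
      rw [← hs₁] at h1 h1'
      rw [← hs₂] at h2 h2'
      have hms : m ≤ s₁ + s₂ := by
        by_contra! hlt
        have : (p : ℤ) * (s₁ + s₂ + 1) ≤ p * m := mul_le_mul_of_nonneg_left hlt hp0.le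
        rw [hj] at hm
        linarith
      have hE := val_mul_ge vL (hsign a.1) (ih a.1 hlt hpos (by omega) s₁ h1)
      have hEP := val_mul_ge vL hE (hpsum a.2 s₂ h2)
      refine le_trans ?_ hEP
      rw [WithTop.coe_le_coe]
      have := mul_le_mul_of_nonneg_left hms hp0.le
      linarith
  rwa [vL.map_mul, hjL, zero_add] at hgoal

lemma val_norm_one_add_sub (hdeg : Module.finrank K L = p) (hext : Extends vK vL p)
    (hπ : vL π = ((1 : ℤ) : WithTop ℤ)) (ht : 1 ≤ t)
    (hjump : ∀ σ : L ≃ₐ[K] L, σ ≠ 1 → vL (σ π - π) = ((t + 1 : ℤ) : WithTop ℤ))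
    (hunit : ∀ j : ℕ, 0 < j → j < p → vK (j : K) = 0) {y : L} {n m : ℤ}
    (hy : (n : WithTop ℤ) ≤ vL y) (hn : 0 ≤ n) (hm : p * m ≤ 2 * n + (p - 1) * (t + 1)) :
    (m : WithTop ℤ) ≤ vK (Algebra.norm K (1 + y) -
      (1 + Algebra.trace K L y + Algebra.norm K y)) := by
  rw [← coe_mul_le_nsmul hp.out.pos, ← hext.2]
  have hE := val_aeval_esymm_ge hdeg hext hπ ht hjump hunit hy
  set E : ℕ → L := fun j =>
    MvPolynomial.aeval (fun σ : L ≃ₐ[K] L => σ y) (MvPolynomial.esymm (L ≃ₐ[K] L) ℤ j) with hEdef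
  have hEsum : ∀ j, E j = ∑ s ∈ Finset.powersetCard j (Finset.univ : Finset (L ≃ₐ[K] L)), ∏ σ ∈ s, σ y := by
    intro j
    simp [hEdef, MvPolynomial.esymm]
  have hnorm : algebraMap K L (Algebra.norm K (1 + y)) = ∑ j ∈ Finset.range (p + 1), E j := by
    rw [Algebra.norm_eq_prod_automorphisms]
    simp only [map_add, map_one, hEsum]
    rw [Finset.prod_one_add, Finset.sum_powerset, card_aut_univ hdeg]
  have hE0 : E 0 = 1 := by simp [hEsum]
  have hE1 : E 1 = algebraMap K L (Algebra.trace K L y) := by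
    rw [trace_eq_sum_automorphisms, hEsum, Finset.powersetCard_one, Finset.sum_map]
    simp
  have hEp : E p = algebraMap K L (Algebra.norm K y) := by
    rw [Algebra.norm_eq_prod_automorphisms, hEsum, ← card_aut_univ (K := K) (L := L) hdeg,
      Finset.powersetCard_self, Finset.sum_singleton]
  have e : algebraMap K L (Algebra.norm K (1 + y) -
      (1 + Algebra.trace K L y + Algebra.norm K y)) = ∑ j ∈ Finset.Ico 2 p, E j := by
    rw [(algebraMap K L).map_sub, hnorm, (algebraMap K L).map_add, (algebraMap K L).map_add,
      map_one, Finset.sum_range_succ,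
      ← Finset.sum_range_add_sum_Ico _ hp.out.two_le, Finset.sum_range_succ, Finset.sum_range_one,
      hE0, hE1, hEp]
    ring
  rw [e]
  refine vL.map_le_sum fun j hj => ?_
  rw [Finset.mem_Ico] at hj
  refine hE j (by omega) hj.2 m (hm.trans ?_)
  have : (2 : ℤ) ≤ j := by exact_mod_cast hj.1
  nlinarith

end TraceNorm

section LocalField

open Filter Topology

/-- Congruence modulo the maximal ideal on the valuation ring of `v`. -/
def residueSetoid {F : Type*} [Field F] (v : AddValuation F (WithTop ℤ)) :
    Setoid {x : F // ((0 : ℤ) : WithTop ℤ) ≤ v x} where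
  r x y := ((1 : ℤ) : WithTop ℤ) ≤ v ((x : F) - y)
  iseqv :=
    { refl := fun x => by simp
      symm := fun {x y} h => by rwa [v.map_sub_swap]
      trans := fun {x y z} h h' => by
        have := v.map_le_add h h'
        rwa [sub_add_sub_cancel] at this }

section Normed

variable {p : ℕ} [hp : Fact p.Prime] {K : Type*} [NontriviallyNormedField K]
  [NormedAlgebra ℚ_[p] K] [FiniteDimensional ℚ_[p] K]
  {v : AddValuation K (WithTop ℤ)} {eK : ℕ}

lemma exists_pos_le_val_of_norm_lt (hv : IsPadicValuation p v eK) (N : ℤ) :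
    ∃ ε > 0, ∀ x : K, ‖x‖ < ε → (N : WithTop ℤ) ≤ v x := by
  set b := Module.finBasis ℚ_[p] K with hb
  choose c hc using fun i => exists_coe_eq_of_ne_zero v (b.ne_zero i)
  set M : ℤ := |N| + ∑ i, |c i| with hM
  have hp0 : (0 : ℝ) < (p : ℝ) ^ (-M) := zpow_pos (by exact_mod_cast hp.out.pos) _
  have hcont : Tendsto (fun x : K => ‖b.equivFunL x‖) (𝓝 0) (𝓝 0) := by
    have := (b.equivFunL.continuous.norm).tendsto 0
    simpa using this
  obtain ⟨ε, hε, h⟩ := Metric.eventually_nhds_iff.1 (hcont.eventually (gt_mem_nhds hp0))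
  refine ⟨ε, hε, fun x hx => ?_⟩
  have hlt := h (y := x) (by rwa [dist_zero_right])
  rw [← b.sum_repr x]
  refine v.map_le_sum fun i _ => ?_
  have hi : ‖b.repr x i‖ < (p : ℝ) ^ (-M) :=
    (norm_le_pi_norm (b.equivFunL x) i).trans_lt hlt
  by_cases h0 : b.repr x i = 0
  · simp [h0]
  rw [Padic.norm_eq_zpow_neg_valuation h0,
    zpow_lt_zpow_iff_right₀ (by exact_mod_cast hp.out.one_lt)] at hi
  rw [Algebra.smul_def, v.map_mul, hv.2.2 _ h0, hc, ← WithTop.coe_add, WithTop.coe_le_coe]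
  have h1 : |c i| ≤ ∑ j, |c j| :=
    Finset.single_le_sum (f := fun j => |c j|) (fun j _ => abs_nonneg _) (Finset.mem_univ i)
  have h2 : (1 : ℤ) ≤ eK := by exact_mod_cast hv.2.1
  have h3 := neg_abs_le (c i)
  have h4 := le_abs_self N
  have h5 := abs_nonneg N
  have h6 := abs_nonneg (c i)
  nlinarith

lemma norm_le_one_of_val_nonneg (hv : IsPadicValuation p v eK) {x : K}
    (hx : ((0 : ℤ) : WithTop ℤ) ≤ v x) : ‖x‖ ≤ 1 := by
  by_contra! hlt
  obtain ⟨ε, hε, h⟩ := exists_pos_le_val_of_norm_lt hv 1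
  have hx0 : x ≠ 0 := norm_pos_iff.1 (zero_lt_one.trans hlt)
  obtain ⟨k, hk⟩ := exists_pow_lt_of_lt_one hε (inv_lt_one_of_one_lt₀ hlt)
  have h1 := h (x⁻¹ ^ k) (by rwa [norm_pow, norm_inv])
  have h2 := val_mul_ge v h1 (val_pow_ge v hx k)
  rw [← mul_pow, inv_mul_cancel₀ hx0, one_pow, v.map_one] at h2
  norm_cast at h2

omit [FiniteDimensional ℚ_[p] K] in
lemma norm_natCast_prime_lt_one : ‖(p : K)‖ < 1 := by
  have : ‖algebraMap ℚ_[p] K p‖ < 1 := by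
    rw [norm_algebraMap']
    exact Padic.norm_p_lt_one
  rwa [map_natCast] at this

lemma exists_norm_lt_of_le_val (hv : IsPadicValuation p v eK) {ε : ℝ} (hε : 0 < ε) :
    ∃ N : ℤ, ∀ x : K, (N : WithTop ℤ) ≤ v x → ‖x‖ < ε := by
  obtain ⟨k, hk⟩ := exists_pow_lt_of_lt_one hε (norm_natCast_prime_lt_one (p := p) (K := K))
  have hpv : v ((p : K) ^ k) = ((k * eK : ℤ) : WithTop ℤ) := by
    rw [v.map_pow, val_natCast_of_padic hv hp.out.ne_zero, padicValNat_self, coe_mul_eq_nsmul]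
    simp
  refine ⟨k * eK, fun x hx => lt_of_le_of_lt ?_ hk⟩
  have h1 := val_div_of_eq v hx hpv
  rw [sub_self] at h1
  have h2 := norm_le_one_of_val_nonneg hv h1
  have h0 := norm_pos_iff.2 (ne_zero_of_val_eq_coe v hpv)
  rwa [norm_div, div_le_one h0, norm_pow] at h2

lemma exists_pow_prime_eq_of_normed (hv : IsPadicValuation p v eK) :
    ∃ M : ℤ, ∀ u : K, (M : WithTop ℤ) ≤ v (u - 1) → ∃ x : K, x ^ p = u := by
  have : CompleteSpace K := FiniteDimensional.complete ℚ_[p] K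
  have hp0 : (p : K) ≠ 0 :=
    ne_zero_of_val_eq_coe v (val_natCast_of_padic hv hp.out.ne_zero)
  have hmap := (hasStrictDerivAt_pow p (1 : K)).map_nhds_eq (by simpa using hp0)
  rw [one_pow] at hmap
  have hmem : Set.range (fun x : K => x ^ p) ∈ 𝓝 (1 : K) := by
    rw [← hmap]
    exact range_mem_map
  obtain ⟨ε, hε, hsub⟩ := Metric.mem_nhds_iff.1 hmem
  obtain ⟨M, hM⟩ := exists_norm_lt_of_le_val hv hε
  exact ⟨M, fun u hu => hsub (by rw [Metric.mem_ball, dist_eq_norm]; exact hM _ hu)⟩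

lemma finite_residue_of_normed (hv : IsPadicValuation p v eK) :
    Finite (Quotient (residueSetoid v)) := by
  have : ProperSpace K := FiniteDimensional.proper ℚ_[p] K
  obtain ⟨ε, hε, h⟩ := exists_pos_le_val_of_norm_lt hv 1
  obtain ⟨s, hs, hcov⟩ :=
    Metric.totallyBounded_iff.1 (isCompact_closedBall (0 : K) 1).totallyBounded ε hε
  have hrep : ∀ q : Quotient (residueSetoid v), ∃ r : s,
      ((1 : ℤ) : WithTop ℤ) ≤ v ((q.out : K) - r) := by
    intro q
    have hmem : (q.out : K) ∈ Metric.closedBall (0 : K) 1 := by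
      rw [mem_closedBall_zero_iff]
      exact norm_le_one_of_val_nonneg hv q.out.2
    obtain ⟨r, hr, hball⟩ := Set.mem_iUnion₂.1 (hcov hmem)
    exact ⟨⟨r, hr⟩, h _ (by rwa [Metric.mem_ball, dist_eq_norm] at hball)⟩
  choose c hc using hrep
  have : Finite s := hs
  refine Finite.of_injective c fun q q' hqq => ?_
  rw [← q.out_eq, ← q'.out_eq]
  refine Quotient.sound ?_
  have h' := hc q'
  rw [v.map_sub_swap, ← hqq] at h'
  have := v.map_le_add (hc q) h'
  rwa [sub_add_sub_cancel] at this

end Normed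

variable {p : ℕ} [hp : Fact p.Prime] {K : Type*} [Field K] [Algebra ℚ_[p] K]
  [FiniteDimensional ℚ_[p] K] {v : AddValuation K (WithTop ℤ)} {eK : ℕ}

/-- Elements sufficiently close to `1` are `p`-th powers. -/
lemma exists_pow_prime_eq (hv : IsPadicValuation p v eK) :
    ∃ M : ℤ, ∀ u : K, (M : WithTop ℤ) ≤ v (u - 1) → ∃ x : K, x ^ p = u := by
  let := spectralNorm.nontriviallyNormedField ℚ_[p] K
  let : NormedAlgebra ℚ_[p] K := spectralNorm.normedAlgebra ℚ_[p] K
  exact exists_pow_prime_eq_of_normed hv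

/-- The residue field is finite. -/
lemma finite_residue (hv : IsPadicValuation p v eK) : Finite (Quotient (residueSetoid v)) := by
  let := spectralNorm.nontriviallyNormedField ℚ_[p] K
  let : NormedAlgebra ℚ_[p] K := spectralNorm.normedAlgebra ℚ_[p] K
  exact finite_residue_of_normed hv

end LocalField

section NormGroup

open Polynomial

lemma one_le_val_of_mul {F : Type*} [Field F] (v : AddValuation F (WithTop ℤ)) {c x : F} {n : ℤ}
    (hc : v c = n) (h : ((n + 1 : ℤ) : WithTop ℤ) ≤ v (c * x)) :
    ((1 : ℤ) : WithTop ℤ) ≤ v x := by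
  have := val_div_of_eq v h hc
  rwa [mul_div_cancel_left₀ _ (ne_zero_of_val_eq_coe v hc), add_sub_cancel_left] at this

lemma Extends.le_val_algebraMap {p : ℕ} {K L : Type*} [Field K] [Field L] [Algebra K L]
    {vK : AddValuation K (WithTop ℤ)} {vL : AddValuation L (WithTop ℤ)} (hext : Extends vK vL p)
    {a : K} {m : ℤ} (hm : 0 ≤ m) (ha : (m : WithTop ℤ) ≤ vK a) :
    (m : WithTop ℤ) ≤ vL (algebraMap K L a) := by
  rw [hext.2]
  refine le_trans ?_ ((coe_mul_le_nsmul hext.1).2 ha)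
  have : (1 : ℤ) ≤ p := by exact_mod_cast hext.1
  rw [WithTop.coe_le_coe]
  nlinarith

variable {p : ℕ} [hp : Fact p.Prime] {K L : Type*} [Field K] [Field L] [Algebra K L]
  [FiniteDimensional K L]
  {vK : AddValuation K (WithTop ℤ)} {vL : AddValuation L (WithTop ℤ)}
  (hdeg : Module.finrank K L = p) (hext : Extends vK vL p) (hGal : GalInvariant K vL)
  {π : L} (hπ : vL π = ((1 : ℤ) : WithTop ℤ)) {t : ℤ} (ht : 1 ≤ t)
  (hjump : ∀ σ : L ≃ₐ[K] L, σ ≠ 1 → vL (σ π - π) = ((t + 1 : ℤ) : WithTop ℤ))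
  (hunit : ∀ j : ℕ, 0 < j → j < p → vK (j : K) = 0)

include hdeg hext hπ in
/-- The extension of residue fields is trivial. -/
lemma exists_val_sub_algebraMap_ge {x : L} (hx : ((0 : ℤ) : WithTop ℤ) ≤ vL x) :
    ∃ a : K, ((0 : ℤ) : WithTop ℤ) ≤ vK a ∧
      ((1 : ℤ) : WithTop ℤ) ≤ vL (x - algebraMap K L a) := by
  obtain ⟨P, hP, rfl⟩ := exists_aeval_eq hdeg hext hπ x
  have hcoeff : ∀ i, ((0 : ℤ) : WithTop ℤ) ≤ vK (P.coeff i) := by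
    intro i
    by_cases hi : i < p
    · have h := hx.trans (val_aeval_le hext hπ P hP i hi)
      have h' : ((-i : ℤ) : WithTop ℤ) ≤ p • vK (P.coeff i) := by
        revert h
        induction p • vK (P.coeff i) using WithTop.recTopCoe with
        | top => simp
        | coe a =>
          intro h
          norm_cast at h ⊢
          linarith
      exact coe_le_of_lt_nsmul hp.out.pos h' (by omega)
    · rw [coeff_eq_zero_of_natDegree_lt (by omega)]
      simp
  refine ⟨P.coeff 0, hcoeff 0, ?_⟩
  have e : aeval π P - algebraMap K L (P.coeff 0) = aeval π P.divX * π := by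
    conv_lhs => rw [← P.divX_mul_X_add]
    simp
  have hdiv : ((0 : ℤ) : WithTop ℤ) ≤ vL (aeval π P.divX) := by
    rw [aeval_eq_sum_range]
    refine vL.map_le_sum fun i _ => ?_
    rw [Algebra.smul_def, coeff_divX]
    have h0 : ((0 : ℤ) : WithTop ℤ) ≤ vL π := by
      rw [hπ]
      exact_mod_cast zero_le_one
    have := val_mul_ge vL (hext.le_val_algebraMap le_rfl (hcoeff (i + 1))) (val_pow_ge vL h0 i)
    rwa [mul_zero, add_zero] at this
  have := val_mul_ge vL hdiv hπ.ge
  rwa [e]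

variable [IsGalois K L]

include hdeg hext hGal hπ ht hjump hunit

lemma exists_val_div_norm_sub_one_ge {u : K} {n : ℤ} (hn : t + 1 ≤ n)
    (hu : (n : WithTop ℤ) ≤ vK (u - 1)) :
    ∃ z : L, z ≠ 0 ∧ ((n + 1 : ℤ) : WithTop ℤ) ≤ vK (u / Algebra.norm K z - 1) := by
  have hp2 : (2 : ℤ) ≤ p := by exact_mod_cast hp.out.two_le
  obtain ⟨y, hytr, hy⟩ := exists_trace_eq hdeg hext hπ hjump hu
  have hψ : n + 1 ≤ p * n - (p - 1) * t := by nlinarith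
  have h1 := val_norm_one_add_sub hdeg hext hπ ht hjump hunit hy (m := n + 1) (by linarith)
    (by nlinarith)
  have hy1 : ((n + 1 : ℤ) : WithTop ℤ) ≤ vL y := le_trans (by exact_mod_cast hψ) hy
  have hz0 : vL (1 + y) = 0 := by
    refine val_eq_zero_of_sub_one vL ?_
    rw [add_sub_cancel_left]
    refine le_trans ?_ hy1
    rw [WithTop.coe_le_coe]
    linarith
  refine ⟨1 + y, ne_zero_of_val_eq_coe vL (n := 0) hz0, ?_⟩
  refine val_div_sub_one vK ((val_norm hdeg hext hGal _).trans hz0) ?_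
  have hNy : ((n + 1 : ℤ) : WithTop ℤ) ≤ vK (Algebra.norm K y) := by
    rwa [val_norm hdeg hext hGal]
  have h2 := vK.map_le_add h1 hNy
  rw [vK.map_sub_swap]
  convert h2 using 2
  rw [hytr]
  ring

/-- Units that are close enough to `1` to be `p`-th powers are norms; successive approximation
brings all of `U_K^{t+1}` into this range. -/
lemma exists_norm_eq_of_le_val {M : ℤ}
    (hM : ∀ u : K, (M : WithTop ℤ) ≤ vK (u - 1) → ∃ x : K, x ^ p = u) {u : K}
    (hu : ((t + 1 : ℤ) : WithTop ℤ) ≤ vK (u - 1)) : ∃ z : L, Algebra.norm K z = u := by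
  have key : ∀ (k : ℕ) (n : ℤ) (u : K), M ≤ n + k → t + 1 ≤ n → (n : WithTop ℤ) ≤ vK (u - 1) →
      ∃ z : L, Algebra.norm K z = u := by
    intro k
    induction k with
    | zero =>
      intro n u hMn _ hu
      obtain ⟨x, rfl⟩ := hM u (le_trans (by exact_mod_cast (by simpa using hMn)) hu)
      exact ⟨algebraMap K L x, by rw [Algebra.norm_algebraMap, hdeg]⟩
    | succ k ih =>
      intro n u hMn hn hu
      obtain ⟨z, hz, hval⟩ :=
        exists_val_div_norm_sub_one_ge hdeg hext hGal hπ ht hjump hunit hn hu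
      obtain ⟨w, hw⟩ := ih (n + 1) _ (by push_cast at hMn; linarith) (by linarith) hval
      exact ⟨w * z, by rw [map_mul, hw, div_mul_cancel₀ _ (Algebra.norm_ne_zero_iff.2 hz)]⟩
  exact key (M - (t + 1)).toNat (t + 1) u (by have := Int.self_le_toNat (M - (t + 1)); linarith)
    le_rfl hu

omit hGal in
lemma val_norm_one_add_sub_norm {y : L} {n m : ℤ} (hn : 0 ≤ n) (hy : (n : WithTop ℤ) ≤ vL y)
    (hm : p * m ≤ n + (p - 1) * (t + 1)) :
    (m : WithTop ℤ) ≤ vK (Algebra.norm K (1 + y) - 1 - Algebra.norm K y) := by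
  have h := vK.map_le_add
    (val_norm_one_add_sub hdeg hext hπ ht hjump hunit hy (m := m) hn (by linarith))
    (val_trace_ge hdeg hext hπ hjump hy hm)
  convert h using 2
  ring

/-- An element whose norm lies in `U_K^t` is congruent to `1` modulo `𝔪_L^t`. -/
lemma le_val_sub_one_of_norm {z : L} (hz : (t : WithTop ℤ) ≤ vK (Algebra.norm K z - 1)) :
    (t : WithTop ℤ) ≤ vL (z - 1) := by
  have hp2 : (2 : ℤ) ≤ p := by exact_mod_cast hp.out.two_le
  have hz0 : vL z = 0 := by
    rw [← val_norm hdeg hext hGal]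
    exact val_eq_zero_of_sub_one vK (le_trans (by exact_mod_cast ht) hz)
  have key : ∀ i : ℕ, (i : ℤ) ≤ t → ((i : ℤ) : WithTop ℤ) ≤ vL (z - 1) := by
    intro i
    induction i with
    | zero =>
      intro _
      exact vL.map_le_sub hz0.ge vL.map_one.ge
    | succ i ih =>
      intro hi
      push_cast at hi ⊢
      have hy := ih (by linarith)
      have h := val_norm_one_add_sub_norm hdeg hext hπ ht hjump hunit (m := i + 1)
        (by positivity) hy (by nlinarith)
      rw [add_sub_cancel] at h
      have hz' : ((i + 1 : ℤ) : WithTop ℤ) ≤ vK (Algebra.norm K z - 1) :=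
        le_trans (by exact_mod_cast hi) hz
      have := vK.map_le_sub hz' h
      rwa [sub_sub_cancel, val_norm hdeg hext hGal] at this
  have := key t.toNat (by omega)
  rwa [Int.toNat_of_nonneg (by omega)] at this

lemma le_val_norm_sub_one {z : L} (hz : ((t + 1 : ℤ) : WithTop ℤ) ≤ vL (z - 1)) :
    ((t + 1 : ℤ) : WithTop ℤ) ≤ vK (Algebra.norm K z - 1) := by
  have h := val_norm_one_add_sub_norm hdeg hext hπ ht hjump hunit (m := t + 1)
    (by linarith) hz (by linarith)
  rw [add_sub_cancel] at h
  have hN : ((t + 1 : ℤ) : WithTop ℤ) ≤ vK (Algebra.norm K (z - 1)) := by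
    rwa [val_norm hdeg hext hGal]
  have := vK.map_le_add h hN
  rwa [sub_add_cancel] at this

/-- On `U_L^t` the norm modulo `U_K^{t+1}` depends only on the leading coefficient. -/
lemma le_val_norm_sub_norm {d z w : L} (hd : vL d = t) {a b : K}
    (hz : ((1 : ℤ) : WithTop ℤ) ≤ vL ((z - 1) / d - algebraMap K L a))
    (hw : ((1 : ℤ) : WithTop ℤ) ≤ vL ((w - 1) / d - algebraMap K L b)) (hw1 : vL w = 0)
    (hab : ((1 : ℤ) : WithTop ℤ) ≤ vK (a - b)) :
    ((t + 1 : ℤ) : WithTop ℤ) ≤ vK (Algebra.norm K z - Algebra.norm K w) := by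
  have hd0 := ne_zero_of_val_eq_coe vL hd
  have h1 := vL.map_le_add (vL.map_le_sub hz hw) (hext.le_val_algebraMap zero_le_one hab)
  have h2 := val_mul_ge vL hd.ge h1
  have e : d * ((z - 1) / d - algebraMap K L a - ((w - 1) / d - algebraMap K L b) +
      algebraMap K L (a - b)) = z - w := by
    rw [map_sub]
    field_simp
    ring
  rw [e] at h2
  have h3 := le_val_norm_sub_one hdeg hext hGal hπ ht hjump hunit (val_div_sub_one vL hw1 h2)
  have hNw : vK (Algebra.norm K w) = 0 := by rw [val_norm hdeg hext hGal, hw1]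
  have h4 := val_mul_ge vK (n := 0) h3 hNw.ge
  rw [add_zero] at h4
  rwa [sub_mul, one_mul, ← map_mul,
    div_mul_cancel₀ _ (ne_zero_of_val_eq_coe vL (n := 0) hw1)] at h4

/-- Some unit in `U_K^t` is not a norm: otherwise counting residues would make the map induced
by the norm on `U_L^t / U_L^{t+1}` injective, although it kills the class of `σ π / π`. -/
lemma exists_not_norm (hfin : Finite (Quotient (residueSetoid vK))) {c : K} (hc : vK c = t)
    {d : L} (hd : vL d = t) {σ : L ≃ₐ[K] L} (hσ : σ ≠ 1) :
    ∃ u : K, (t : WithTop ℤ) ≤ vK (u - 1) ∧ ∀ z : L, Algebra.norm K z ≠ u := by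
  by_contra! hall
  have hlead : ∀ z : L, (t : WithTop ℤ) ≤ vL (z - 1) →
      ∃ a : {x : K // ((0 : ℤ) : WithTop ℤ) ≤ vK x},
        ((1 : ℤ) : WithTop ℤ) ≤ vL ((z - 1) / d - algebraMap K L a) := by
    intro z hz
    have := val_div_of_eq vL hz hd
    rw [sub_self] at this
    obtain ⟨a, ha, h⟩ := exists_val_sub_algebraMap_ge hdeg hext hπ this
    exact ⟨⟨a, ha⟩, h⟩
  have hzero : ∀ z : L, (t : WithTop ℤ) ≤ vL (z - 1) → vL z = 0 := fun z hz =>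
    val_eq_zero_of_sub_one vL (le_trans (by exact_mod_cast ht) hz)
  have hex : ∀ q : Quotient (residueSetoid vK), ∃ z : L,
      Algebra.norm K z = 1 + c * (q.out : K) ∧ (t : WithTop ℤ) ≤ vL (z - 1) := by
    intro q
    have hq : (t : WithTop ℤ) ≤ vK (1 + c * (q.out : K) - 1) := by
      have := val_mul_ge vK hc.ge q.out.2
      rwa [add_zero, ← add_sub_cancel_left 1 (c * (q.out : K))] at this
    obtain ⟨z, hz⟩ := hall _ hq
    exact ⟨z, hz, le_val_sub_one_of_norm hdeg hext hGal hπ ht hjump hunit (by rwa [hz])⟩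
  choose z hzN hz1 using hex
  choose a ha using fun q => hlead (z q) (hz1 q)
  let g : Quotient (residueSetoid vK) → Quotient (residueSetoid vK) := fun q => ⟦a q⟧
  have hg : Function.Injective g := by
    intro q q' hqq
    have h := le_val_norm_sub_norm hdeg hext hGal hπ ht hjump hunit hd (ha q) (ha q')
      (hzero _ (hz1 q')) (Quotient.exact hqq)
    rw [hzN, hzN, add_sub_add_left_eq_sub, ← mul_sub] at h
    rw [← q.out_eq, ← q'.out_eq]
    exact Quotient.sound (one_le_val_of_mul vK hc h)
  have hsurj : Function.Surjective g := Finite.surjective_of_injective hg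
  have hker : ∀ (w : L) (b : {x : K // ((0 : ℤ) : WithTop ℤ) ≤ vK x}), Algebra.norm K w = 1 →
      vL w = 0 → ((1 : ℤ) : WithTop ℤ) ≤ vL ((w - 1) / d - algebraMap K L b) →
      ∃ q, g q = ⟦b⟧ ∧ ((1 : ℤ) : WithTop ℤ) ≤ vK (q.out : K) := by
    intro w b hwN hw0 hwb
    obtain ⟨q, hq⟩ := hsurj ⟦b⟧
    refine ⟨q, hq, ?_⟩
    have h := le_val_norm_sub_norm hdeg hext hGal hπ ht hjump hunit hd (ha q) hwb hw0
      (Quotient.exact hq)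
    rw [hzN, hwN, add_sub_cancel_left] at h
    exact one_le_val_of_mul vK hc h
  have hw : vL (σ π / π - 1) = t := by
    have e : (σ π / π - 1) * π = σ π - π := by
      have := ne_zero_of_val_eq_coe vL hπ
      field_simp
    have h := hjump σ hσ
    rw [← e, vL.map_mul, hπ] at h
    revert h
    induction vL (σ π / π - 1) using WithTop.recTopCoe with
    | top => exact fun h => absurd h WithTop.top_ne_coe
    | coe a =>
      intro h
      norm_cast at h ⊢
      linarith
  have hwN : Algebra.norm K (σ π / π) = 1 := by
    have hπ0 := ne_zero_of_val_eq_coe vL hπ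
    refine mul_right_cancel₀ (Algebra.norm_ne_zero_iff.2 hπ0) ?_
    rw [← map_mul, div_mul_cancel₀ _ hπ0, one_mul, Algebra.norm_eq_of_algEquiv]
  obtain ⟨b, hb⟩ := hlead _ hw.ge
  obtain ⟨q, hq, hq1⟩ := hker _ b hwN (hzero _ hw.ge) hb
  obtain ⟨q₀, hq₀, hq₀1⟩ := hker 1 ⟨0, by simp⟩ (map_one _) vL.map_one (by simp)
  have hqq : q = q₀ := by
    rw [← q.out_eq, ← q₀.out_eq]
    exact Quotient.sound (vK.map_le_sub hq1 hq₀1)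
  rw [hqq, hq₀] at hq
  have hb0 : ((1 : ℤ) : WithTop ℤ) ≤ vK ((0 : K) - b) := Quotient.exact hq
  rw [zero_sub, vK.map_neg] at hb0
  have h := vL.map_le_add hb (hext.le_val_algebraMap zero_le_one hb0)
  rw [sub_add_cancel] at h
  have h' := val_mul_ge vL hd.ge h
  rw [mul_div_cancel₀ _ (ne_zero_of_val_eq_coe vL hd), hw] at h'
  norm_cast at h'
  omega

end NormGroup

/-- Proposition 5. For a totally ramified Galois extension `L/K` of
degree `p` with upper ramification jump `t`, one has
`t = min{j ∈ ℕ ∣ U_K^{j+1} ⊆ N_{L/K}(L^×)}`. -/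
theorem statement_6
    (p : ℕ) [Fact p.Prime]
    (K : Type*) [Field K] [Algebra ℚ_[p] K] [FiniteDimensional ℚ_[p] K]
    (vK : AddValuation K (WithTop ℤ)) (eK : ℕ)
    (hvK : IsPadicValuation p vK eK)
    (L : Type*) [Field L] [Algebra K L] [FiniteDimensional K L] [IsGalois K L]
    (hdeg : Module.finrank K L = p)
    (vL : AddValuation L (WithTop ℤ))
    (hvL : IsNormalized vL)
    (hext : Extends vK vL p)
    (hGal : GalInvariant K vL)
    (t : ℤ) (ht : IsUpperJump vL hGal t) :
    t = sInf {j : ℤ | 0 ≤ j ∧ ∀ u : Kˣ,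
      ((j + 1 : ℤ) : WithTop ℤ) ≤ vK ((u : K) - 1) → u ∈ normGroup K L} := by
  obtain ⟨π, hπ⟩ := hvL 1
  have hvp : ((1 : ℤ) : WithTop ℤ) ≤ vK (p : K) := by
    rw [val_natCast_of_padic hvK (Fact.out : p.Prime).ne_zero, padicValNat_self]
    have := hvK.2.1
    norm_cast
    omega
  have hunit : ∀ j : ℕ, 0 < j → j < p → vK (j : K) = 0 := by
    intro j hj0 hjp
    rw [val_natCast_of_padic hvK hj0.ne',
      padicValNat.eq_zero_of_not_dvd (Nat.not_dvd_of_pos_of_lt hj0 hjp)]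
    simp
  obtain ⟨ht1, ⟨σ, hσ⟩, hjump⟩ := val_aut_sub_of_isUpperJump hdeg hext hGal hvp hπ ht
  have hmem : ∀ u : Kˣ, u ∈ normGroup K L ↔ ∃ z : L, Algebra.norm K z = u := by
    intro u
    constructor
    · rintro ⟨z, rfl⟩
      exact ⟨z, rfl⟩
    · rintro ⟨z, hz⟩
      have hz0 : z ≠ 0 := Algebra.norm_ne_zero_iff.1 (hz ▸ u.ne_zero)
      exact ⟨Units.mk0 z hz0, Units.ext hz⟩
  symm
  refine IsLeast.csInf_eq ⟨⟨by linarith, fun u hu => (hmem u).2 ?_⟩, ?_⟩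
  · obtain ⟨M, hM⟩ := exists_pow_prime_eq hvK
    exact exists_norm_eq_of_le_val hdeg hext hGal hπ ht1 hjump hunit hM hu
  · rintro j ⟨-, hj⟩
    by_contra! hlt
    obtain ⟨c, hc⟩ := hvK.1 t
    obtain ⟨d, hd⟩ := hvL t
    obtain ⟨u, hu, hnot⟩ := exists_not_norm hdeg hext hGal hπ ht1 hjump hunit
      (finite_residue hvK) hc hd hσ
    have hu0 : u ≠ 0 := ne_zero_of_val_eq_coe vK (n := 0)
      (val_eq_zero_of_sub_one vK (le_trans (by exact_mod_cast ht1) hu))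
    obtain ⟨z, hz⟩ := (hmem (Units.mk0 u hu0)).1
      (hj _ (le_trans (by exact_mod_cast hlt) hu))
    exact hnot z hz
end PaperRam
end
end

section
/- Assume ζ_p ∈ K and let a ∈ K^× with 0 < v_K(a) < p. Then L = K(a^{1/p}) is a cyclic extension of K of degree p whose upper ramification jump equals p·e_K/(p−1). -/
noncomputable section

open scoped Classical

namespace PaperRam

variable {K F : Type*} [Field K] [Field F] [Algebra K F]

/-- If the finite values of the summands are pairwise distinct, then the valuation of the sum is
the minimum of the valuations. -/
theorem val_sum_eq_inf {F ι : Type*} [Field F] (v : AddValuation F (WithTop ℤ)) (s : Finset ι)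
    (f : ι → F) (hf : ∀ i ∈ s, ∀ j ∈ s, v (f i) = v (f j) → v (f i) ≠ ⊤ → i = j) :
    v (∑ i ∈ s, f i) = s.inf fun i => v (f i) := by
  induction s using Finset.induction_on with
  | empty => simp
  | insert i s his ih =>
    have ih' := ih fun j hj k hk =>
      hf j (Finset.mem_insert_of_mem hj) k (Finset.mem_insert_of_mem hk)
    rw [Finset.sum_insert his, Finset.inf_insert, ← ih']
    by_cases htop : v (f i) = ⊤
    · rw [htop, v.top_iff.mp htop]
      simp
    · refine v.map_add_of_distinct_val fun heq => htop ?_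
      rcases s.eq_empty_or_nonempty with rfl | hs
      · simpa using heq
      · obtain ⟨j, hj, hj'⟩ := Finset.exists_mem_eq_inf s hs fun i => v (f i)
        have := hf i (Finset.mem_insert_self i s) j (Finset.mem_insert_of_mem hj)
          (heq.trans (ih'.trans hj')) htop
        exact absurd (this ▸ hj) his

theorem nsmul_top_of_ne_zero {n : ℕ} (hn : n ≠ 0) : n • (⊤ : WithTop ℤ) = ⊤ := by
  obtain ⟨n, rfl⟩ := Nat.exists_eq_succ_of_ne_zero hn
  rw [succ_nsmul, WithTop.add_top]

theorem coe_nsmul_int (n : ℕ) (z : ℤ) : n • (z : WithTop ℤ) = ((n * z : ℤ) : WithTop ℤ) := by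
  rw [← WithTop.coe_nsmul, nsmul_eq_mul]

theorem val_pow_sub_one_ge {F : Type*} [Field F] (v : AddValuation F (WithTop ℤ)) {ζ : F}
    (hζ : 0 ≤ v ζ) (i : ℕ) : v (ζ - 1) ≤ v (ζ ^ i - 1) := by
  rw [← mul_geom_sum ζ i, v.map_mul]
  refine le_add_of_nonneg_right (v.map_le_sum fun j _ => ?_)
  rw [v.map_pow]
  exact nsmul_nonneg hζ j

theorem val_eq_zero_of_pow_eq_one {F : Type*} [Field F] (v : AddValuation F (WithTop ℤ)) {ζ : F}
    {n : ℕ} (hn : 0 < n) (hζ : ζ ^ n = 1) : v ζ = 0 := by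
  have h := v.map_pow ζ n
  rw [hζ, v.map_one] at h
  have h0 : ζ ≠ 0 := by
    rintro rfl
    rw [zero_pow hn.ne'] at hζ
    exact zero_ne_one hζ
  obtain ⟨z, hz⟩ := WithTop.ne_top_iff_exists.mp (v.ne_top_iff.mpr h0)
  rw [← hz, coe_nsmul_int] at h
  have h' : (n : ℤ) * z = 0 := (WithTop.coe_eq_coe.mp h).symm
  have : z = 0 := by
    rcases mul_eq_zero.mp h' with h' | h'
    · omega
    · exact h'
  rw [← hz, this]
  rfl

/-- For a primitive `p`-th root of unity `μ`, `(p - 1) v(μ - 1) = v(p)`. -/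
theorem val_primitiveRoot_sub_one {F : Type*} [Field F] (v : AddValuation F (WithTop ℤ))
    {p : ℕ} [hp : Fact p.Prime] {ζ : F} (hζ : IsPrimitiveRoot ζ p) {e : ℤ}
    (he : v (p : F) = (e : WithTop ℤ)) :
    ∃ n : ℤ, ((p : ℤ) - 1) * n = e ∧ ∀ μ : F, IsPrimitiveRoot μ p → v (μ - 1) = n := by
  have hge : ∀ μ ν : F, IsPrimitiveRoot μ p → IsPrimitiveRoot ν p → v (μ - 1) ≤ v (ν - 1) := by
    intro μ ν hμ hν
    obtain ⟨i, -, rfl⟩ := hμ.eq_pow_of_pow_eq_one hν.pow_eq_one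
    exact val_pow_sub_one_ge v (val_eq_zero_of_pow_eq_one v hp.out.pos hμ.pow_eq_one).ge i
  obtain ⟨n, hn⟩ := WithTop.ne_top_iff_exists.mp
    (v.ne_top_iff.mpr (sub_ne_zero.mpr (hζ.ne_one hp.out.one_lt)))
  have hval : ∀ μ : F, IsPrimitiveRoot μ p → v (μ - 1) = n := fun μ hμ =>
    (le_antisymm (hge μ ζ hμ hζ) (hge ζ μ hζ hμ)).trans hn.symm
  refine ⟨n, ?_, hval⟩
  have hprod : (p : F) = ∏ μ ∈ primitiveRoots p F, (1 - μ) := by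
    rw [← Polynomial.eval_one_cyclotomic_prime (R := F) (p := p),
      Polynomial.cyclotomic_eq_prod_X_sub_primitiveRoots hζ, Polynomial.eval_prod]
    simp
  have hsum : ∀ s ⊆ primitiveRoots p F,
      v (∏ μ ∈ s, (1 - μ)) = ((s.card * n : ℤ) : WithTop ℤ) := by
    intro s hs
    induction s using Finset.induction_on with
    | empty => simp
    | insert μ s hμ ih =>
      rw [Finset.prod_insert hμ, v.map_mul, ih fun x hx => hs (Finset.mem_insert_of_mem hx),
        v.map_sub_swap, hval μ (isPrimitiveRoot_of_mem_primitiveRoots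
          (hs (Finset.mem_insert_self μ s))), Finset.card_insert_of_notMem hμ, ← WithTop.coe_add]
      congr 1
      push_cast
      ring
  have := hsum _ subset_rfl
  rw [← hprod, he, hζ.card_primitiveRoots, Nat.totient_prime hp.out,
    Nat.cast_sub hp.out.one_le] at this
  exact_mod_cast (WithTop.coe_eq_coe.mp this).symm

section Radical

variable {K L : Type*} [Field K] [Field L] [Algebra K L]
  {p : ℕ} {vK : AddValuation K (WithTop ℤ)} {vL : AddValuation L (WithTop ℤ)}
  {e : ℕ} {a : K} {m : ℤ} {α : L}

theorem val_term {k : ℕ} (hext : Extends vK vL (p * k))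
    (hvα : vL α = ((k * m : ℤ) : WithTop ℤ)) (c : K) (i : ℕ) :
    vL (algebraMap K L c * α ^ i) = ⊤ ∨
      ∃ n : ℤ, vL (algebraMap K L c * α ^ i) = ((k * (p * n + i * m) : ℤ) : WithTop ℤ) := by
  by_cases hc : c = 0
  · left
    simp [hc]
  · right
    obtain ⟨n, hn⟩ := WithTop.ne_top_iff_exists.mp (vK.ne_top_iff.mpr hc)
    refine ⟨n, ?_⟩
    rw [vL.map_mul, hext.2, vL.map_pow, hvα, ← hn, coe_nsmul_int, coe_nsmul_int, ← WithTop.coe_add]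
    congr 1
    push_cast
    ring

variable [hp : Fact p.Prime]

theorem val_root (hext : Extends vK vL e) (ha : vK a = m) (hm0 : 0 < m) (hmp : m < p)
    (hα : α ^ p = algebraMap K L a) :
    ∃ k : ℕ, 0 < k ∧ e = p * k ∧ vL α = ((k * m : ℤ) : WithTop ℤ) := by
  have h := vL.map_pow α p
  rw [hα, hext.2, ha, coe_nsmul_int] at h
  have h0 : α ≠ 0 := by
    rintro rfl
    rw [vL.map_zero, nsmul_top_of_ne_zero hp.out.ne_zero] at h
    exact WithTop.coe_ne_top h
  obtain ⟨w, hw⟩ := WithTop.ne_top_iff_exists.mp (vL.ne_top_iff.mpr h0)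
  rw [← hw, coe_nsmul_int] at h
  have h : (e : ℤ) * m = p * w := WithTop.coe_eq_coe.mp h
  have hpm : ¬ (p : ℤ) ∣ m := fun hd => by have := Int.le_of_dvd hm0 hd; omega
  have hpe : (p : ℤ) ∣ e :=
    ((Nat.prime_iff_prime_int.mp hp.out).dvd_or_dvd (Dvd.intro _ h.symm)).resolve_right hpm
  obtain ⟨k, rfl⟩ := Int.natCast_dvd_natCast.mp hpe
  have hp0 : (p : ℤ) ≠ 0 := by exact_mod_cast hp.out.ne_zero
  refine ⟨k, Nat.pos_of_mul_pos_left hext.1, rfl, ?_⟩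
  rw [← hw, WithTop.coe_eq_coe]
  apply mul_left_cancel₀ hp0
  rw [← h]
  push_cast
  ring

theorem val_expansion {k : ℕ} (hk : 0 < k) (hext : Extends vK vL (p * k)) (hm0 : 0 < m)
    (hmp : m < p) (hvα : vL α = ((k * m : ℤ) : WithTop ℤ)) (c : ℕ → K) :
    vL (∑ i ∈ Finset.range p, algebraMap K L (c i) * α ^ i) =
      (Finset.range p).inf fun i => vL (algebraMap K L (c i) * α ^ i) := by
  refine val_sum_eq_inf vL _ _ fun i hi j hj hij htop => ?_
  obtain ⟨n, hn⟩ := (val_term hext hvα (c i) i).resolve_left htop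
  obtain ⟨n', hn'⟩ := (val_term hext hvα (c j) j).resolve_left (hij ▸ htop)
  rw [hn, hn', WithTop.coe_eq_coe] at hij
  have hk' : (k : ℤ) ≠ 0 := by omega
  have h := mul_left_cancel₀ hk' hij
  have hpm : ¬ (p : ℤ) ∣ m := fun hd => by have := Int.le_of_dvd hm0 hd; omega
  have hd : (p : ℤ) ∣ ((i : ℤ) - j) * m := ⟨n' - n, by linear_combination h⟩
  have hd := ((Nat.prime_iff_prime_int.mp hp.out).dvd_or_dvd hd).resolve_right hpm
  rw [Finset.mem_range] at hi hj
  have := Int.eq_zero_of_abs_lt_dvd hd (by rw [abs_lt]; constructor <;> omega)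
  omega

theorem exists_term_of_val_eq {k : ℕ} (hk : 0 < k) (hext : Extends vK vL (p * k)) (hm0 : 0 < m)
    (hmp : m < p) (hvα : vL α = ((k * m : ℤ) : WithTop ℤ)) (c : ℕ → K) {z : ℤ}
    (hz : vL (∑ i ∈ Finset.range p, algebraMap K L (c i) * α ^ i) = z) :
    ∃ i ∈ Finset.range p, vL (algebraMap K L (c i) * α ^ i) = z := by
  rw [val_expansion hk hext hm0 hmp hvα] at hz
  obtain ⟨i, hi, hi'⟩ := Finset.exists_mem_eq_inf (Finset.range p)
    (Finset.nonempty_range_iff.mpr hp.out.ne_zero) fun i => vL (algebraMap K L (c i) * α ^ i)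
  exact ⟨i, hi, hi'.symm.trans hz⟩

/-- Adjoining a `p`-th root of an element of valuation prime to `p` is totally ramified. -/
theorem ramificationIndex_eq_and_val_root (hvL : IsNormalized vL) (hext : Extends vK vL e)
    (ha : vK a = m) (hm0 : 0 < m) (hmp : m < p) (hα : α ^ p = algebraMap K L a)
    (hspan : ∀ x : L, ∃ c : ℕ → K, x = ∑ i ∈ Finset.range p, algebraMap K L (c i) * α ^ i) :
    e = p ∧ vL α = m := by
  obtain ⟨k, hk, rfl, hvα⟩ := val_root hext ha hm0 hmp hα
  obtain ⟨x, hx⟩ := hvL 1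
  obtain ⟨c, rfl⟩ := hspan x
  obtain ⟨i, -, hi⟩ := exists_term_of_val_eq hk hext hm0 hmp hvα c hx
  rcases val_term hext hvα (c i) i with h | ⟨n, h⟩
  · rw [hi] at h
    exact absurd h WithTop.coe_ne_top
  · rw [hi, WithTop.coe_eq_coe] at h
    have hk1 : (k : ℤ) = 1 := Int.eq_one_of_dvd_one (by omega) ⟨_, h⟩
    rw [hvα, hk1, one_mul]
    refine ⟨?_, rfl⟩
    rw [show k = 1 by omega, mul_one]

/-- For `σ ≠ 1`, the valuation of `σ x - x` is at least `t + 1` on integral elements, and this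
bound is attained. -/
theorem val_galois_sub (hvL : IsNormalized vL) (hext : Extends vK vL p)
    (hm0 : 0 < m) (hmp : m < p) (hvα : vL α = m) (h0 : α ≠ 0)
    (hα : α ^ p = algebraMap K L a)
    (hspan : ∀ x : L, ∃ c : ℕ → K, x = ∑ i ∈ Finset.range p, algebraMap K L (c i) * α ^ i)
    {ζ : K} (hζ : IsPrimitiveRoot ζ p) {t : ℤ}
    (ht : ∀ μ : L, IsPrimitiveRoot μ p → vL (μ - 1) = t) {σ : L ≃ₐ[K] L} (hσ : σ ≠ 1) :
    (∀ x : L, 0 ≤ vL x → ((t + 1 : ℤ) : WithTop ℤ) ≤ vL (σ x - x)) ∧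
      ∃ x : L, 0 ≤ vL x ∧ vL (σ x - x) = ((t + 1 : ℤ) : WithTop ℤ) := by
  have hζL : IsPrimitiveRoot (algebraMap K L ζ) p :=
    hζ.map_of_injective (algebraMap K L).injective
  have hext1 : Extends vK vL (p * 1) := by rwa [mul_one]
  have hvα1 : vL α = (((1 : ℕ) * m : ℤ) : WithTop ℤ) := by simpa using hvα
  obtain ⟨j, hj, hσα⟩ : ∃ j < p, σ α = algebraMap K L (ζ ^ j) * α := by
    have : (σ α / α) ^ p = 1 := by
      rw [div_pow, ← map_pow, hα, σ.commutes, div_self]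
      rw [← hα]
      exact pow_ne_zero _ h0
    obtain ⟨j, hj, h⟩ := hζL.eq_pow_of_pow_eq_one this
    exact ⟨j, hj, by rw [map_pow, h, div_mul_cancel₀ _ h0]⟩
  have happ : ∀ c : ℕ → K, σ (∑ i ∈ Finset.range p, algebraMap K L (c i) * α ^ i) -
      ∑ i ∈ Finset.range p, algebraMap K L (c i) * α ^ i =
      ∑ i ∈ Finset.range p, algebraMap K L ((ζ ^ (j * i) - 1) * c i) * α ^ i := by
    intro c
    rw [map_sum, ← Finset.sum_sub_distrib]
    refine Finset.sum_congr rfl fun i _ => ?_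
    rw [map_mul, map_pow, σ.commutes, hσα]
    simp only [map_mul, map_sub, map_pow, map_one]
    ring
  have hj0 : j ≠ 0 := by
    rintro rfl
    apply hσ
    ext x
    obtain ⟨c, rfl⟩ := hspan x
    rw [AlgEquiv.one_apply, ← sub_eq_zero, happ]
    simp
  have hterm : ∀ (c : K) (i : ℕ), i ≠ 0 → i < p →
      vL (algebraMap K L ((ζ ^ (j * i) - 1) * c) * α ^ i) =
        t + vL (algebraMap K L c * α ^ i) := by
    intro c i hi hip
    have hcop : (j * i).Coprime p := by
      refine Nat.Coprime.symm ((Nat.Prime.coprime_iff_not_dvd hp.out).mpr fun hd => ?_)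
      rcases hp.out.dvd_mul.mp hd with hd | hd
      · exact absurd (Nat.le_of_dvd (by omega) hd) (by omega)
      · exact absurd (Nat.le_of_dvd (by omega) hd) (by omega)
    rw [map_mul (algebraMap K L), mul_assoc, vL.map_mul, map_sub (algebraMap K L),
      map_pow (algebraMap K L), map_one (algebraMap K L), ht _ (hζL.pow_of_coprime _ hcop)]
  have hzero : ∀ c : K, algebraMap K L ((ζ ^ (j * 0) - 1) * c) * α ^ 0 = 0 := by
    intro c
    simp
  constructor
  · intro x hx
    obtain ⟨c, rfl⟩ := hspan x
    rw [happ]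
    refine vL.map_le_sum fun i hi => ?_
    by_cases hi0 : i = 0
    · rw [hi0, hzero, vL.map_zero]
      exact le_top
    · have hip := Finset.mem_range.mp hi
      rw [hterm _ _ hi0 hip]
      rcases val_term hext1 hvα1 (c i) i with h | ⟨n, h⟩
      · rw [h]
        simp
      · have hx' : (0 : WithTop ℤ) ≤ vL (algebraMap K L (c i) * α ^ i) := by
          refine hx.trans ?_
          rw [val_expansion one_pos hext1 hm0 hmp hvα1]
          exact Finset.inf_le hi
        rw [h] at hx' ⊢
        have hx' : (0 : ℤ) ≤ (1 : ℕ) * (p * n + i * m) := by exact_mod_cast hx'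
        rw [← WithTop.coe_add, WithTop.coe_le_coe]
        have hne : (p : ℤ) * n + i * m ≠ 0 := by
          intro h0
          have hd : (p : ℤ) ∣ i * m := ⟨-n, by linear_combination h0⟩
          rcases (Nat.prime_iff_prime_int.mp hp.out).dvd_or_dvd hd with hd | hd
          · have := Int.le_of_dvd (by omega) hd; omega
          · have := Int.le_of_dvd hm0 hd; omega
        push_cast at hx' ⊢
        omega
  · obtain ⟨x, hx⟩ := hvL 1
    obtain ⟨c, rfl⟩ := hspan x
    refine ⟨_, by rw [hx]; exact_mod_cast zero_le_one, ?_⟩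
    obtain ⟨i, hi, hi'⟩ := exists_term_of_val_eq one_pos hext1 hm0 hmp hvα1 c hx
    have hi0 : i ≠ 0 := by
      rintro rfl
      rcases val_term hext1 hvα1 (c 0) 0 with h | ⟨n, h⟩
      · rw [hi'] at h
        exact WithTop.coe_ne_top h
      · rw [hi', WithTop.coe_eq_coe] at h
        have : (p : ℤ) ∣ 1 := ⟨n, by push_cast at h; linear_combination h⟩
        have := Int.le_of_dvd one_pos this
        have := hp.out.one_lt
        omega
    rw [happ, val_expansion one_pos hext1 hm0 hmp hvα1]
    apply le_antisymm
    · refine (Finset.inf_le hi).trans ?_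
      rw [hterm _ _ hi0 (Finset.mem_range.mp hi), hi', ← WithTop.coe_add]
    · refine Finset.le_inf fun l hl => ?_
      by_cases hl0 : l = 0
      · rw [hl0, hzero, vL.map_zero]
        exact le_top
      · rw [hterm _ _ hl0 (Finset.mem_range.mp hl), WithTop.coe_add]
        gcongr
        rw [← hx, val_expansion one_pos hext1 hm0 hmp hvα1]
        exact Finset.inf_le hl

end Radical

section Jump

variable {v : AddValuation F (WithTop ℤ)} {hv : GalInvariant K v} {t : ℤ}

theorem herbrandPhi_of_le (ht : 0 ≤ t) (htop : ∀ i ≤ t, lowerRG v hv i = ⊤)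
    [Finite (F ≃ₐ[K] F)] {n : ℤ} (hn : n ≤ t) : herbrandPhi v hv n = n := by
  unfold herbrandPhi
  split_ifs with h0
  · rfl
  · have hc : (Nat.card (F ≃ₐ[K] F) : ℚ) ≠ 0 := Nat.cast_ne_zero.mpr Nat.card_pos.ne'
    have hs : ∀ i ∈ Finset.Icc (1 : ℤ) n,
        (Nat.card (lowerRG v hv i) : ℚ) = Nat.card (F ≃ₐ[K] F) := by
      intro i hi
      rw [htop i ((Finset.mem_Icc.mp hi).2.trans hn), Subgroup.card_top]
    rw [Finset.sum_congr rfl hs, htop 0 ht, Subgroup.card_top, Finset.sum_const, nsmul_eq_mul,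
      mul_div_cancel_right₀ _ hc, Int.card_Icc]
    have : ((n + 1 - 1).toNat : ℤ) = n := by omega
    exact_mod_cast this

theorem herbrandPhi_of_ge (ht : 0 ≤ t) (htop : ∀ i ≤ t, lowerRG v hv i = ⊤)
    (hbot : ∀ i, t < i → lowerRG v hv i = ⊥)
    [Finite (F ≃ₐ[K] F)] {n : ℤ} (hn : t ≤ n) :
    herbrandPhi v hv n = t + (n - t) / Nat.card (F ≃ₐ[K] F) := by
  have hc : (Nat.card (F ≃ₐ[K] F) : ℚ) ≠ 0 := Nat.cast_ne_zero.mpr Nat.card_pos.ne'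
  induction n, hn using Int.leInduction with
  | base =>
    rw [herbrandPhi_of_le ht htop le_rfl]
    simp
  | succ n hn ih =>
    have hstep : herbrandPhi v hv (n + 1) = herbrandPhi v hv n + 1 / Nat.card (F ≃ₐ[K] F) := by
      have hIcc : Finset.Icc (1 : ℤ) (n + 1) = insert (n + 1) (Finset.Icc 1 n) := by
        ext i
        simp only [Finset.mem_Icc, Finset.mem_insert]
        omega
      unfold herbrandPhi
      rw [if_neg (by omega), hIcc, Finset.sum_insert (by simp), hbot (n + 1) (by omega),
        htop 0 ht, Subgroup.card_top, Subgroup.card_bot]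
      split_ifs with h0
      · have : n = 0 := by omega
        subst this
        simp
      · push_cast
        ring
    rw [hstep, ih]
    push_cast
    ring

theorem upperRG_eq (ht : 0 ≤ t) (htop : ∀ i ≤ t, lowerRG v hv i = ⊤)
    (hbot : ∀ i, t < i → lowerRG v hv i = ⊥) [Finite (F ≃ₐ[K] F)] (u : ℤ) :
    upperRG v hv u = if u ≤ t then ⊤ else ⊥ := by
  have hc : (0 : ℚ) < Nat.card (F ≃ₐ[K] F) := Nat.cast_pos.mpr Nat.card_pos
  have hlb : ∀ n ∈ {n : ℤ | (u : ℚ) ≤ herbrandPhi v hv n}, min u (t + 1) ≤ n := by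
    intro n hn
    rw [Set.mem_ofPred_eq] at hn
    by_contra! hlt
    rw [herbrandPhi_of_le ht htop (by omega)] at hn
    have : u ≤ n := by exact_mod_cast hn
    omega
  unfold upperRG
  split_ifs with hu
  · refine htop _ ((csInf_le ⟨_, hlb⟩ ?_).trans hu)
    rw [Set.mem_ofPred_eq, herbrandPhi_of_le ht htop hu]
  · have hne : {n : ℤ | (u : ℚ) ≤ herbrandPhi v hv n}.Nonempty := by
      refine ⟨t + (u - t) * Nat.card (F ≃ₐ[K] F), ?_⟩
      rw [Set.mem_ofPred_eq, herbrandPhi_of_ge ht htop hbot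
        (le_add_of_nonneg_right (mul_nonneg (by omega) (by positivity)))]
      push_cast
      field_simp
      apply le_of_eq
      ring
    have := le_csInf hne hlb
    exact hbot _ (by omega)

/-- If the lower ramification filtration drops from the full group to the trivial group at `t`,
then `t` is the unique upper ramification jump. -/
theorem isUpperJump_iff (ht : 0 ≤ t) (htop : ∀ i ≤ t, lowerRG v hv i = ⊤)
    (hbot : ∀ i, t < i → lowerRG v hv i = ⊥) [Finite (F ≃ₐ[K] F)] [Nontrivial (F ≃ₐ[K] F)]
    (s : ℤ) : IsUpperJump v hv s ↔ s = t := by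
  unfold IsUpperJump
  simp only [upperRG_eq ht htop hbot]
  constructor
  · intro h
    by_contra hne
    apply h (s + 1) (by omega)
    rcases lt_or_gt_of_ne hne with hlt | hlt
    · rw [if_pos (by omega), if_pos (by omega)]
    · rw [if_neg (by omega), if_neg (by omega)]
  · rintro rfl u hu
    rw [if_neg (by omega), if_pos le_rfl]
    exact bot_ne_top

end Jump

theorem irreducible_X_pow_sub_C_of_val {p : ℕ} [hp : Fact p.Prime]
    {vK : AddValuation K (WithTop ℤ)} {a : K} {m : ℤ} (ha : vK a = m) (hm0 : 0 < m)
    (hmp : m < p) : Irreducible (Polynomial.X ^ p - Polynomial.C a) := by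
  refine X_pow_sub_C_irreducible_of_prime hp.out fun b hb => ?_
  have h := vK.map_pow b p
  rw [hb, ha] at h
  have h0 : b ≠ 0 := by
    rintro rfl
    rw [vK.map_zero, nsmul_top_of_ne_zero hp.out.ne_zero] at h
    exact WithTop.coe_ne_top h
  obtain ⟨w, hw⟩ := WithTop.ne_top_iff_exists.mp (vK.ne_top_iff.mpr h0)
  rw [← hw, coe_nsmul_int, WithTop.coe_eq_coe] at h
  have := Int.le_of_dvd hm0 ⟨w, h⟩
  omega

/-- Proposition 14, first case. If `ζ_p ∈ K` and `a ∈ K^×` with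
`0 < v_K(a) < p`, then `L = K(a^{1/p})` is cyclic of degree `p` with upper ramification
jump `p·e_K/(p-1)`. -/
theorem statement_10
    (p : ℕ) [Fact p.Prime]
    (K : Type*) [Field K] [Algebra ℚ_[p] K] [FiniteDimensional ℚ_[p] K]
    (vK : AddValuation K (WithTop ℤ)) (eK : ℕ)
    (hvK : IsPadicValuation p vK eK)
    (hζ : ∃ ζ : K, IsPrimitiveRoot ζ p)
    (t' : ℤ) (ht' : ((p : ℤ) - 1) * t' = (p : ℤ) * eK)
    (Ω : Type*) [Field Ω] [Algebra K Ω] [IsAlgClosure K Ω]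
    (a : K) (ha0 : (0 : WithTop ℤ) < vK a) (hap : vK a < ((p : ℤ) : WithTop ℤ))
    (α : Ω) (hα : α ^ p = algebraMap K Ω a)
    (vL : AddValuation ↥(IntermediateField.adjoin K {α}) (WithTop ℤ)) (eL : ℕ)
    (hvL : IsNormalized vL) (hext : Extends vK vL eL) (hGal : GalInvariant K vL) :
    Module.finrank K ↥(IntermediateField.adjoin K {α}) = p ∧
    IsCyclic (↥(IntermediateField.adjoin K {α}) ≃ₐ[K] ↥(IntermediateField.adjoin K {α})) ∧
    (∀ s : ℤ, IsUpperJump vL hGal s ↔ s = t') := by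
  obtain ⟨ζ, hζ⟩ := hζ
  have hp : p.Prime := Fact.out
  obtain ⟨m, hm⟩ := WithTop.ne_top_iff_exists.mp (ne_top_of_lt hap)
  rw [← hm] at ha0 hap
  have hm0 : 0 < m := by exact_mod_cast ha0
  have hmp : m < p := WithTop.coe_lt_coe.mp hap
  have hirr := irreducible_X_pow_sub_C_of_val hm.symm hm0 hmp
  have hmonic : (Polynomial.X ^ p - Polynomial.C a).Monic :=
    Polynomial.monic_X_pow_sub_C a hp.ne_zero
  have hroot : Polynomial.aeval α (Polynomial.X ^ p - Polynomial.C a) = 0 := by simp [hα]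
  have hint : IsIntegral K α := ⟨_, hmonic, hroot⟩
  have hminpoly : minpoly K α = Polynomial.X ^ p - Polynomial.C a :=
    (minpoly.eq_of_irreducible_of_monic hirr hroot hmonic).symm
  have hfin : Module.finrank K ↥(IntermediateField.adjoin K {α}) = p := by
    rw [IntermediateField.adjoin.finrank hint, hminpoly, Polynomial.natDegree_X_pow_sub_C]
  have hfd : FiniteDimensional K ↥(IntermediateField.adjoin K {α}) :=
    IntermediateField.adjoin.finiteDimensional hint
  set β : ↥(IntermediateField.adjoin K {α}) := IntermediateField.AdjoinSimple.gen K α with hβdef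
  have hβ : β ^ p = algebraMap K _ a := by
    apply Subtype.ext
    simpa [hβdef] using hα
  have hspan : ∀ x : ↥(IntermediateField.adjoin K {α}), ∃ c : ℕ → K,
      x = ∑ i ∈ Finset.range p, algebraMap K _ (c i) * β ^ i := by
    intro x
    let pb := IntermediateField.adjoin.powerBasis hint
    have hdim : pb.dim = p := by
      rw [← pb.finrank, hfin]
    have hgen : pb.gen = β := IntermediateField.adjoin.powerBasis_gen hint
    obtain ⟨f, hf, rfl⟩ := pb.exists_eq_aeval x
    refine ⟨f.coeff, ?_⟩
    rw [Polynomial.aeval_eq_sum_range' (hdim ▸ hf), hgen]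
    simp only [Algebra.smul_def]
  have hroots : (primitiveRoots p K).Nonempty := ⟨ζ, (mem_primitiveRoots hp.pos).mpr hζ⟩
  have hroots' :
      (primitiveRoots (Module.finrank K ↥(IntermediateField.adjoin K {α})) K).Nonempty := by
    rwa [hfin]
  have hsplit : Polynomial.IsSplittingField K ↥(IntermediateField.adjoin K {α})
      (Polynomial.X ^ p - Polynomial.C a) := by
    have := isSplittingField_X_pow_sub_C_of_root_adjoin_eq_top (a := a) (α := β) hroots'
      (by rw [hfin]; exact hβ)
      (eq_top_iff.mpr fun x _ => by
        obtain ⟨c, rfl⟩ := hspan x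
        exact sum_mem fun i _ => mul_mem (IntermediateField.algebraMap_mem _ _)
          (pow_mem (IntermediateField.mem_adjoin_simple_self K β) i))
    rwa [hfin] at this
  have hgal : IsGalois K ↥(IntermediateField.adjoin K {α}) :=
    isGalois_of_isSplittingField_X_pow_sub_C hroots hirr _
  refine ⟨hfin, isCyclic_of_isSplittingField_X_pow_sub_C hroots hirr _, ?_⟩
  have hcard := IsGalois.card_aut_eq_finrank K ↥(IntermediateField.adjoin K {α})
  have hnt : Nontrivial (↥(IntermediateField.adjoin K {α}) ≃ₐ[K]
      ↥(IntermediateField.adjoin K {α})) := by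
    rw [← Finite.one_lt_card_iff_nontrivial, hcard, hfin]
    exact hp.one_lt
  obtain ⟨rfl, hvβ⟩ := ramificationIndex_eq_and_val_root hvL hext hm.symm hm0 hmp hβ hspan
  have hβ0 : β ≠ 0 := by
    rw [← vL.ne_top_iff, hvβ]
    exact WithTop.coe_ne_top
  have hvp : vL ((eL : ℕ) : ↥(IntermediateField.adjoin K {α})) =
      ((eL * eK : ℤ) : WithTop ℤ) := by
    have h := hvK.2.2 (eL : ℚ_[eL]) (by exact_mod_cast hp.ne_zero)
    rw [Padic.valuation_p, mul_one, map_natCast] at h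
    rw [← map_natCast (algebraMap K _), hext.2, h, coe_nsmul_int]
  obtain ⟨t, ht, hval⟩ := val_primitiveRoot_sub_one vL
    (hζ.map_of_injective (algebraMap K ↥(IntermediateField.adjoin K {α})).injective) hvp
  have hp1 : (0 : ℤ) < (eL : ℤ) - 1 := by have := hp.one_lt; omega
  obtain rfl : t = t' := mul_left_cancel₀ hp1.ne' (ht.trans ht'.symm)
  have ht0 : 0 ≤ t := by
    refine nonneg_of_mul_nonneg_right (b := t) (a := (eL : ℤ) - 1) ?_ hp1
    rw [ht]
    positivity
  have hσ := fun σ (h : σ ≠ 1) => val_galois_sub hvL hext hm0 hmp hvβ hβ0 hβ hspan hζ hval (σ := σ) h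
  refine isUpperJump_iff ht0 ?_ ?_
  · intro i hi
    refine eq_top_iff.mpr fun σ _ => ?_
    by_cases h1 : σ = 1
    · rw [h1]
      exact one_mem _
    · exact fun x hx => (WithTop.coe_le_coe.mpr (by omega)).trans ((hσ σ h1).1 x hx)
  · intro i hi
    refine (Subgroup.eq_bot_iff_forall _).mpr fun σ hmem => ?_
    by_contra h1
    obtain ⟨x, hx, hx'⟩ := (hσ σ h1).2
    have := hmem x hx
    rw [hx', WithTop.coe_le_coe] at this
    omega
end PaperRam
end
end
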